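/- arXiv:2511.20805 — 5 statements merged into one kernel-verified Lean document; each statement's English description precedes it below -/
import Mathlib

section
/- Let d ≥ 2 be an integer and let P be a maximal two-dimensional lattice polygon contained in ℝ × [0, d], meeting both lines ℝ × {0} and ℝ × {d}, and with lattice width equal to d. If there exists an integer i with 1 ≤ i ≤ d − 1 such that ∂P contains at most one point of ℤ × {i}, then r(P) ≤ |P ∩ (ℤ × {0})| + |P ∩ (ℤ × {d})| + 2d − 4. -/
open Set

noncomputable section

/-- Embedding of the integer lattice `ℤ × ℤ` into the real plane. -/
def latticeEmbed (p : ℤ × ℤ) : ℝ × ℝ := ((p.1 : ℝ), (p.2 : ℝ))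

/-- A lattice polygon: the convex hull of a nonempty finite set of lattice points. -/
def IsLatticePolygon (P : Set (ℝ × ℝ)) : Prop :=
  ∃ S : Finset (ℤ × ℤ), S.Nonempty ∧
    P = convexHull ℝ (latticeEmbed '' (S : Set (ℤ × ℤ)))

/-- The interior lattice points of a set in the plane. -/
def interiorLatticePoints (P : Set (ℝ × ℝ)) : Set (ℤ × ℤ) :=
  {p : ℤ × ℤ | latticeEmbed p ∈ interior P}

/-- The genus of a lattice polygon: the number of interior lattice points. -/
def polygonGenus (P : Set (ℝ × ℝ)) : ℕ := (interiorLatticePoints P).ncard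

/-- The number of lattice points on the boundary. -/
def boundaryLatticeCount (P : Set (ℝ × ℝ)) : ℕ :=
  {p : ℤ × ℤ | latticeEmbed p ∈ frontier P}.ncard

/-- A subset of the plane is two-dimensional if it has nonempty interior. -/
def TwoDimensional (P : Set (ℝ × ℝ)) : Prop := (interior P).Nonempty

/-- A `ℤ`-affine transformation of the plane: `p ↦ A p + b` with `A ∈ GL₂(ℤ)`, `b ∈ ℤ²`. -/
def IsZAffine (φ : ℝ × ℝ → ℝ × ℝ) : Prop :=
  ∃ a b c d e f : ℤ, (a * d - b * c = 1 ∨ a * d - b * c = -1) ∧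
    ∀ p : ℝ × ℝ,
      φ p = ((a : ℝ) * p.1 + (b : ℝ) * p.2 + (e : ℝ),
             (c : ℝ) * p.1 + (d : ℝ) * p.2 + (f : ℝ))

/-- The horizontal strip `ℝ × [0, s]`. -/
def strip (s : ℝ) : Set (ℝ × ℝ) := {q : ℝ × ℝ | 0 ≤ q.2 ∧ q.2 ≤ s}

/-- `LatticeWidthIs P d` : `d` is the smallest positive integer `s` such that some
`ℤ`-affine transformation maps `P` into the strip `ℝ × [0, s]`. -/
def LatticeWidthIs (P : Set (ℝ × ℝ)) (d : ℕ) : Prop :=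
  IsLeast {s : ℕ | 0 < s ∧ ∃ φ, IsZAffine φ ∧ φ '' P ⊆ strip (s : ℝ)} d

/-- An edge of a polygon: an exposed face of dimension one. -/
def IsEdge (P τ : Set (ℝ × ℝ)) : Prop :=
  IsExposed ℝ P τ ∧ Module.finrank ℝ (vectorSpan ℝ τ) = 1

/-- A column vector of a polygon `P`: a nonzero integer vector `v` such that for some
edge `τ` of `P`, translating all lattice points of `P` off `τ` by `v` stays in `P`. -/
def IsColumnVector (P : Set (ℝ × ℝ)) (v : ℤ × ℤ) : Prop :=
  v ≠ 0 ∧ ∃ τ : Set (ℝ × ℝ), IsEdge P τ ∧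
    ∀ p : ℤ × ℤ, latticeEmbed p ∈ P \ τ → latticeEmbed (p + v) ∈ P

/-- The number of column vectors of `P`. -/
def columnVectorCount (P : Set (ℝ × ℝ)) : ℕ :=
  {v : ℤ × ℤ | IsColumnVector P v}.ncard

/-- A lattice polygon is maximal if no lattice polygon strictly containing it has the
same set of interior lattice points. -/
def IsMaximalPolygon (P : Set (ℝ × ℝ)) : Prop :=
  IsLatticePolygon P ∧
    ∀ Q : Set (ℝ × ℝ), IsLatticePolygon Q → P ⊆ Q →
      interiorLatticePoints Q = interiorLatticePoints P → Q = P

/-- The interior polygon: the convex hull of the interior lattice points. -/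
def interiorPolygon (P : Set (ℝ × ℝ)) : Set (ℝ × ℝ) :=
  convexHull ℝ (latticeEmbed '' interiorLatticePoints P)

/-- A lattice polygon is non-hyperelliptic if its interior polygon is two-dimensional. -/
def NonHyperelliptic (P : Set (ℝ × ℝ)) : Prop := TwoDimensional (interiorPolygon P)

/-- Two polygons are equivalent if one is the image of the other under a
`ℤ`-affine transformation. -/
def EquivPolygon (P Q : Set (ℝ × ℝ)) : Prop := ∃ φ, IsZAffine φ ∧ φ '' P = Q

/-- The triangle `2Υ = conv{(−2,−2),(2,0),(0,2)}`. -/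
def twoUpsilon : Set (ℝ × ℝ) :=
  convexHull ℝ {((-2 : ℝ), (-2 : ℝ)), ((2 : ℝ), (0 : ℝ)), ((0 : ℝ), (2 : ℝ))}

/-- `ExpectedGonalityIs P d` : the expected gonality of `P` is `d`, i.e.
`d = lw(P⁽¹⁾) + 2`, except that polygons equivalent to `2Υ` have expected gonality `3`. -/
def ExpectedGonalityIs (P : Set (ℝ × ℝ)) (d : ℕ) : Prop :=
  (EquivPolygon P twoUpsilon ∧ d = 3) ∨
  (¬ EquivPolygon P twoUpsilon ∧
    ∃ w : ℕ, LatticeWidthIs (interiorPolygon P) w ∧ d = w + 2)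

/-- `Q` contains a crystal of length `d`: a `(d+1) × (d−1)` grid of interior lattice
points occupying columns `x₀, …, x₀ + d` and rows `1, …, d − 1`. -/
def ContainsCrystal (Q : Set (ℝ × ℝ)) (d : ℕ) : Prop :=
  ∃ x₀ : ℤ, ∀ i j : ℤ, 0 ≤ i → i ≤ (d : ℤ) → 1 ≤ j → j ≤ (d : ℤ) - 1 →
    (x₀ + i, j) ∈ interiorLatticePoints Q

/-- The shear transformation `(x, y) ↦ (x + ℓ y, y)`. -/
def shearMap (ℓ : ℤ) : ℝ × ℝ → ℝ × ℝ := fun q => (q.1 + (ℓ : ℝ) * q.2, q.2)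

end

lemma aux_concave (d : ℤ) (w : ℤ → ℝ)
    (hw : ∀ j, 0 < j → j < d → w (j-1) + w (j+1) ≤ 2 * w j) (j : ℤ) (h0 : 0 < j) (h1 : j < d) :
    ∀ k, 0 ≤ k → k ≤ d → w k ≤ w j + (w (j+1) - w j) * ((k:ℝ) - j) := by
  have up : ∀ n : ℕ, j + 1 + n ≤ d → w (j+1+n) - w (j+n) ≤ w (j+1) - w j ∧
      w (j+1+n) ≤ w j + (w (j+1) - w j) * (n+1) := by
    intro n
    induction n with
    | zero => intro _; constructor <;> simp
    | succ n ih =>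
      intro h
      push_cast at h ⊢
      obtain ⟨a, b⟩ := ih (by linarith)
      have := hw (j+1+n) (by omega) (by omega)
      have e1 : j + 1 + (n:ℤ) - 1 = j + n := by ring
      have e2 : j + 1 + (n:ℤ) + 1 = j + 1 + (n + 1) := by ring
      have e3 : j + ((n:ℤ) + 1) = j + 1 + n := by ring
      rw [e1, e2] at this
      rw [e3]
      constructor
      · linarith
      · nlinarith
  have down : ∀ n : ℕ, 0 ≤ j - n → w (j+1) - w j ≤ w (j-n+1) - w (j-n) ∧
      w (j-n) ≤ w j - (w (j+1) - w j) * n := by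
    intro n
    induction n with
    | zero => intro _; constructor <;> simp
    | succ n ih =>
      intro h
      push_cast at h ⊢
      obtain ⟨a, b⟩ := ih (by linarith)
      have := hw (j-n) (by omega) (by omega)
      have e1 : j - (n:ℤ) - 1 = j - (n+1) := by ring
      have e3 : j - ((n:ℤ) + 1) + 1 = j - n := by ring
      rw [e1] at this
      rw [e3]
      constructor
      · linarith
      · nlinarith
  intro k hk0 hkd
  rcases le_or_gt k j with h | h
  · obtain ⟨n, hn⟩ := Int.le.dest h
    obtain rfl : k = j - n := by omega
    have := (down n hk0).2
    push_cast
    linarith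
  · obtain ⟨n, hn⟩ := Int.le.dest h
    obtain rfl : k = j + 1 + n := by omega
    have := (up n hkd).2
    push_cast
    linarith

lemma aux_hull (d : ℤ) (e : ℝ) (w : ℤ → ℝ) (T : Set (ℤ × ℤ))
    (hw : ∀ j, 0 < j → j < d → w (j-1) + w (j+1) ≤ 2 * w j)
    (hT : ∀ p ∈ T, 0 ≤ p.2 ∧ p.2 ≤ d ∧ e * p.1 ≤ w p.2) (j : ℤ) (h0 : 0 < j) (h1 : j < d)
    (x : ℝ) (hx : (x, (j:ℝ)) ∈ convexHull ℝ (latticeEmbed '' T)) : e * x ≤ w j := by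
  have key : convexHull ℝ (latticeEmbed '' T) ⊆
      {q : ℝ × ℝ | e * q.1 - (w (j+1) - w j) * q.2 ≤ w j - (w (j+1) - w j) * j} := by
    apply convexHull_min
    · rintro _ ⟨p, hp, rfl⟩
      obtain ⟨a, b, c⟩ := hT p hp
      have := aux_concave d w hw j h0 h1 p.2 a b
      simp only [latticeEmbed, mem_ofPred_eq]
      linarith
    · intro p hp q hq a b ha hb hab
      simp only [mem_ofPred_eq, Prod.fst_add, Prod.snd_add, Prod.smul_fst, Prod.smul_snd,
        smul_eq_mul] at *
      have h1 := mul_le_mul_of_nonneg_left hp ha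
      have h2 := mul_le_mul_of_nonneg_left hq hb
      have : (a + b) * (w j - (w (j+1) - w j) * j) = w j - (w (j+1) - w j) * j := by
        rw [hab, one_mul]
      nlinarith
  have := key hx
  simp only [mem_ofPred_eq] at this
  linarith

lemma aux_row (S : Finset (ℤ × ℤ)) (e g c : ℝ) (hS : ∀ p ∈ S, c ≤ g * p.2)
    (hq : ∃ q ∈ convexHull ℝ (latticeEmbed '' (S : Set (ℤ × ℤ))), g * q.2 = c) :
    ∃ p ∈ S, g * p.2 = c ∧ ∀ q ∈ convexHull ℝ (latticeEmbed '' (S : Set (ℤ × ℤ))),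
      g * q.2 = c → e * q.1 ≤ e * p.1 := by
  have hne : (S.filter (fun p => g * (p.2:ℝ) = c)).Nonempty := by
    by_contra hcon
    rw [Finset.not_nonempty_iff_eq_empty, Finset.filter_eq_empty_iff] at hcon
    have key : convexHull ℝ (latticeEmbed '' (S : Set (ℤ × ℤ))) ⊆ {q : ℝ × ℝ | c < g * q.2} := by
      apply convexHull_min
      · rintro _ ⟨p, hp, rfl⟩
        exact lt_of_le_of_ne (hS p hp) (fun h => hcon hp h.symm)
      · apply convex_halfSpace_gt
        constructor
        · intro x y; simp; ring
        · intro x y; simp; ring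
    obtain ⟨q, hq, hqc⟩ := hq
    have := key hq
    simp only [mem_ofPred_eq] at this
    linarith
  obtain ⟨p, hp, hmax⟩ := Finset.exists_max_image _ (fun p : ℤ × ℤ => e * (p.1:ℝ)) hne
  rw [Finset.mem_filter] at hp
  refine ⟨p, hp.1, hp.2, ?_⟩
  have key : convexHull ℝ (latticeEmbed '' (S : Set (ℤ × ℤ))) ⊆
      {q : ℝ × ℝ | c ≤ g * q.2 ∧ (g * q.2 = c → e * q.1 ≤ e * p.1)} := by
    apply convexHull_min
    · rintro _ ⟨p', hp', rfl⟩
      exact ⟨hS p' hp', fun h => hmax p' (Finset.mem_filter.2 ⟨hp', h⟩)⟩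
    · intro p1 hp1 p2 hp2 a b ha hb hab
      simp only [mem_ofPred_eq, Prod.fst_add, Prod.snd_add, Prod.smul_fst, Prod.smul_snd,
        smul_eq_mul] at *
      obtain rfl : a = 1 - b := by linarith
      refine ⟨by nlinarith, fun h => ?_⟩
      rcases ha.eq_or_lt with ha0 | ha0
      · obtain rfl : b = 1 := by linarith
        have := hp2.2 (by linarith)
        linarith
      rcases hb.eq_or_lt with hb0 | hb0
      · subst hb0
        have := hp1.2 (by linarith)
        linarith
      have t1 := mul_nonneg ha (sub_nonneg.2 hp1.1)
      have t2 := mul_nonneg hb (sub_nonneg.2 hp2.1)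
      have s1 : (1 - b) * (g * p1.2 - c) = 0 := by nlinarith
      have s2 : b * (g * p2.2 - c) = 0 := by nlinarith
      have u1 := hp1.2 (by rcases mul_eq_zero.1 s1 with h | h <;> linarith)
      have u2 := hp2.2 (by rcases mul_eq_zero.1 s2 with h | h <;> linarith)
      nlinarith
  intro q hq h
  exact (key hq).2 h

lemma aux_int {Q : Set (ℝ × ℝ)} {x y : ℝ} (h : (x, y) ∈ interior Q) :
    ∃ δ > 0, (x + δ, y) ∈ Q ∧ (x - δ, y) ∈ Q ∧ (x, y + δ) ∈ Q ∧ (x, y - δ) ∈ Q := by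
  rw [mem_interior_iff_mem_nhds, Metric.mem_nhds_iff] at h
  obtain ⟨r, hr, hb⟩ := h
  have hr2 : |r| / 2 < r := by rw [abs_of_pos hr]; linarith
  refine ⟨r / 2, by positivity, ?_, ?_, ?_, ?_⟩ <;> apply hb <;>
    simp [Prod.dist_eq, hr, hr2]

lemma aux_mem_int {P : Set (ℝ × ℝ)} (hc : Convex ℝ P) (h2 : (interior P).Nonempty)
    {d : ℝ} (h0 : ∃ q ∈ P, q.2 = (0 : ℝ)) (hdl : ∃ q ∈ P, q.2 = d) {x y x1 x2 : ℝ}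
    (hy0 : 0 < y) (hyd : y < d) (h1 : (x1, y) ∈ P) (h2' : (x2, y) ∈ P) (hx1 : x1 < x)
    (hx2 : x < x2) : (x, y) ∈ interior P := by
  by_contra hcon
  obtain ⟨f, hf⟩ := geometric_hahn_banach_open_point hc.interior isOpen_interior hcon
  have hle : ∀ a ∈ P, f a ≤ f (x, y) := by
    intro a ha
    have : a ∈ closure (interior P) := by
      rw [hc.closure_interior_eq_closure_of_nonempty_interior h2]
      exact subset_closure ha
    have hcl : IsClosed {a | f a ≤ f (x, y)} := isClosed_le f.continuous continuous_const
    exact closure_minimal (fun a ha => (hf a ha).le) hcl this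
  have hform : ∀ a b : ℝ, f (a, b) = a * f (1, 0) + b * f (0, 1) := by
    intro a b
    have : ((a, b) : ℝ × ℝ) = a • (1, 0) + b • (0, 1) := by simp
    rw [this, map_add, map_smul, map_smul]; simp
  obtain ⟨⟨q, q'⟩, hq, hq0⟩ := h0
  obtain ⟨⟨r, r'⟩, hr, hr0⟩ := hdl
  simp only at hq0 hr0
  subst hq0 hr0
  have a1 := hle _ h1
  have a2 := hle _ h2'
  have a3 := hle _ hq
  have a4 := hle _ hr
  obtain ⟨z, hz⟩ := h2
  have a5 := hf z hz
  rw [← Prod.mk.eta (p := z)] at a5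
  have hxy := hform x y
  have hz' := hform z.1 z.2
  have hr' := hform r r'
  have hq' := hform q 0
  have h1f := hform x1 y
  have h2f := hform x2 y
  clear hform hf hle
  generalize f (1, 0) = A at *
  generalize f (0, 1) = B at *
  rw [hxy] at a1 a2 a3 a4 a5
  rw [h1f] at a1
  rw [h2f] at a2
  rw [hq'] at a3
  rw [hr'] at a4
  rw [hz'] at a5
  clear hxy hz' hr' hq' h1f h2f
  have b1 : A = 0 := by
    apply le_antisymm
    · by_contra h; push Not at h; nlinarith
    · by_contra h; push Not at h; nlinarith
  subst b1
  have b2 : B = 0 := by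
    apply le_antisymm
    · by_contra h; push Not at h; nlinarith
    · by_contra h; push Not at h; nlinarith
  subst b2
  linarith

lemma aux_core (d : ℕ) (P : Set (ℝ × ℝ)) (hP : IsMaximalPolygon P) (h2 : TwoDimensional P)
    (hsub : P ⊆ strip (d : ℝ))
    (h0 : ∃ q ∈ P, q.2 = (0 : ℝ)) (hdl : ∃ q ∈ P, q.2 = (d : ℝ))
    (hc : Convex ℝ P)
    (X : ℤ → ℤ → ℝ)
    (hX : ∀ ε j : ℤ, 0 ≤ j → j ≤ d → (X ε j, (j:ℝ)) ∈ P ∧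
      ∀ x, (x, (j:ℝ)) ∈ P → ε * x ≤ ε * X ε j)
    (ε : ℤ) (hε : ε = 1 ∨ ε = -1) (i : ℤ) (hi0 : 0 < i) (hid : i < d)
    (hint : ∀ j : ℤ, 0 ≤ j → j ≤ d → j ≠ i → ∃ u : ℤ, X ε j = u) : ∃ u : ℤ, X ε i = u := by
  obtain ⟨⟨S, hSne, rfl⟩, hmax⟩ := hP
  set P := convexHull ℝ (latticeEmbed '' (S : Set (ℤ × ℤ))) with hPdef
  have hSP : ∀ p ∈ S, latticeEmbed p ∈ P := fun p hp => subset_convexHull _ _ ⟨p, hp, rfl⟩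
  have hconc : ∀ e j : ℤ, 0 < j → j < d →
      e * X e (j-1) + e * X e (j+1) ≤ 2 * (e * X e j) := by
    intro e j hj0 hjd
    have m1 := (hX e (j-1) (by omega) (by omega)).1
    have m2 := (hX e (j+1) (by omega) (by omega)).1
    have m3 := hc m1 m2 (a := 1/2) (b := 1/2) (by norm_num) (by norm_num) (by norm_num)
    have m4 := (hX e j (by omega) (by omega)).2 (1/2 * X e (j-1) + 1/2 * X e (j+1)) (by
      convert m3 using 1
      simp only [Prod.smul_mk, Prod.mk_add_mk, smul_eq_mul, Int.cast_add, Int.cast_sub,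
        Int.cast_one, Prod.mk.injEq, true_and]
      ring)
    linarith
  set t : ℤ := ε * ⌈ε * X ε i⌉ with ht
  have hεε : (ε : ℝ) * ε = 1 := by rcases hε with rfl | rfl <;> norm_num
  have het : (ε : ℝ) * t = ⌈ε * X ε i⌉ := by
    rw [ht]; push_cast; rw [← mul_assoc, hεε, one_mul]
  set T : Finset (ℤ × ℤ) := insert (t, i) S with hT
  set Q := convexHull ℝ (latticeEmbed '' (T : Set (ℤ × ℤ))) with hQ
  have hPQ : P ⊆ Q := convexHull_mono (image_mono (by rw [hT]; simp))
  have htQ : ((t:ℝ), (i:ℝ)) ∈ Q := subset_convexHull _ _ ⟨(t, i), by simp [hT], rfl⟩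
  -- bounds
  have hSr : ∀ p ∈ S, 0 ≤ p.2 ∧ p.2 ≤ d := by
    intro p hp
    have := hsub (hSP p hp)
    simp only [strip, latticeEmbed, mem_ofPred_eq] at this
    exact ⟨by exact_mod_cast this.1, by exact_mod_cast this.2⟩
  have hQsub : Q ⊆ strip (d:ℝ) := by
    apply convexHull_min
    · rintro _ ⟨p, hp, rfl⟩
      have : 0 ≤ p.2 ∧ p.2 ≤ d := by
        simp only [hT, Finset.coe_insert, mem_insert_iff, Finset.mem_coe] at hp
        rcases hp with rfl | hp
        · exact ⟨hi0.le, hid.le⟩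
        · exact hSr p hp
      exact ⟨by simpa [latticeEmbed] using this.1, by
        simp only [latticeEmbed]; exact_mod_cast this.2⟩
    · intro p1 hp1 p2 hp2 a b ha hb hab
      simp only [strip, mem_ofPred_eq, Prod.snd_add, Prod.smul_snd, smul_eq_mul] at *
      obtain rfl : a = 1 - b := by linarith
      constructor <;> nlinarith
  have hintceil : ∀ j : ℤ, 0 ≤ j → j ≤ d → j ≠ i → (⌈ε * X ε j⌉ : ℝ) = ε * X ε j := by
    intro j a b c
    obtain ⟨u, hu⟩ := hint j a b c
    rw [hu, ← Int.cast_mul, Int.ceil_intCast]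
  have hw1 : ∀ j, 0 < j → j < (d:ℤ) →
      ((fun j : ℤ => (⌈ε * X ε j⌉ : ℝ)) (j-1)) + ((fun j : ℤ => (⌈ε * X ε j⌉ : ℝ)) (j+1)) ≤
        2 * ((fun j : ℤ => (⌈ε * X ε j⌉ : ℝ)) j) := by
    intro j hj0 hjd
    simp only
    have hcj := hconc ε j hj0 hjd
    by_cases hji : j = i
    · subst hji
      rw [hintceil (j-1) (by omega) (by omega) (by omega),
        hintceil (j+1) (by omega) (by omega) (by omega)]
      have := Int.le_ceil (ε * X ε j)
      linarith
    · have e0 := hintceil j (by omega) (by omega) hji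
      by_cases hm : j - 1 = i
      · have e1 := hintceil (j+1) (by omega) (by omega) (by omega)
        rw [← e0, ← e1] at hcj
        have : ⌈ε * X ε (j-1)⌉ ≤ 2 * ⌈ε * X ε j⌉ - ⌈ε * X ε (j+1)⌉ := by
          rw [Int.ceil_le]; push_cast; linarith
        have h' : ((⌈ε * X ε (j-1)⌉ : ℤ) : ℝ) ≤ ((2 * ⌈ε * X ε j⌉ - ⌈ε * X ε (j+1)⌉ : ℤ) : ℝ) := by
          exact_mod_cast this
        push_cast at h'
        linarith
      · have e1 := hintceil (j-1) (by omega) (by omega) (by omega)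
        rw [← e0, ← e1] at hcj
        have : ⌈ε * X ε (j+1)⌉ ≤ 2 * ⌈ε * X ε j⌉ - ⌈ε * X ε (j-1)⌉ := by
          rw [Int.ceil_le]; push_cast; linarith
        have h' : ((⌈ε * X ε (j+1)⌉ : ℤ) : ℝ) ≤ ((2 * ⌈ε * X ε j⌉ - ⌈ε * X ε (j-1)⌉ : ℤ) : ℝ) := by
          exact_mod_cast this
        push_cast at h'
        linarith
  have hup := aux_hull d ε (fun j : ℤ => (⌈ε * X ε j⌉ : ℝ)) (T : Set (ℤ × ℤ)) hw1 (by
    intro p hp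
    simp only [hT, Finset.coe_insert, mem_insert_iff, Finset.mem_coe] at hp
    rcases hp with rfl | hp
    · exact ⟨hi0.le, hid.le, het.le⟩
    · obtain ⟨a, b⟩ := hSr p hp
      exact ⟨a, b, ((hX ε p.2 a b).2 _ (hSP p hp)).trans (Int.le_ceil _)⟩)
  have hdn := aux_hull d ((-ε : ℤ) : ℝ) (fun j => ((-ε : ℤ) : ℝ) * X (-ε) j) (T : Set (ℤ × ℤ))
    (hconc (-ε)) (by
    intro p hp
    simp only [hT, Finset.coe_insert, mem_insert_iff, Finset.mem_coe] at hp
    rcases hp with rfl | hp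
    · refine ⟨hi0.le, hid.le, ?_⟩
      have := (hX (-ε) i hi0.le hid.le).2 _ (hX ε i hi0.le hid.le).1
      have h3 := Int.le_ceil (ε * X ε i)
      rw [← het] at h3
      push_cast at *
      linarith
    · obtain ⟨a, b⟩ := hSr p hp
      exact ⟨a, b, ((hX (-ε) p.2 a b).2 _ (hSP p hp))⟩)
  have hQP : Q = P := by
    apply hmax Q ⟨T, by simp [hT], rfl⟩ hPQ
    have hsub2 : interiorLatticePoints P ⊆ interiorLatticePoints Q := by
      intro p hp
      exact interior_mono hPQ (show latticeEmbed p ∈ interior P from hp)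
    refine Subset.antisymm ?_ hsub2
    rintro ⟨x, j⟩ hp
    have hp' : ((x:ℝ), (j:ℝ)) ∈ interior Q := hp
    obtain ⟨δ, hδ, q1, q2, q3, q4⟩ := aux_int hp'
    have hjd : (j:ℝ) < d := by have := (hQsub q3).2; simp only at this; linarith
    have hj0 : (0:ℝ) < j := by have := (hQsub q4).1; simp only at this; linarith
    have hjd' : j < d := by exact_mod_cast hjd
    have hj0' : 0 < j := by exact_mod_cast hj0
    have u1 := hup j hj0' hjd' _ q1
    have u2 := hup j hj0' hjd' _ q2
    have v1 := hdn j hj0' hjd' _ q1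
    have v2 := hdn j hj0' hjd' _ q2
    have k1 : (ε : ℝ) * x < ε * X ε j := by
      have : ((ε * x : ℤ) : ℝ) < ⌈ε * X ε j⌉ := by
        push_cast
        rcases hε with rfl | rfl <;> push_cast at * <;> linarith
      have h' : ε * x < ⌈ε * X ε j⌉ := by exact_mod_cast this
      rw [Int.lt_ceil] at h'
      exact_mod_cast h'
    have k2 : ((-ε : ℤ) : ℝ) * x < ((-ε : ℤ) : ℝ) * X (-ε) j := by
      rcases hε with rfl | rfl <;> push_cast at * <;> linarith
    have m1 := (hX ε j hj0'.le hjd'.le).1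
    have m2 := (hX (-ε) j hj0'.le hjd'.le).1
    show ((x:ℝ), (j:ℝ)) ∈ interior P
    rcases hε with rfl | rfl
    · exact aux_mem_int hc h2 h0 hdl hj0 hjd m2 m1 (by push_cast at *; linarith)
        (by push_cast at *; linarith)
    · exact aux_mem_int hc h2 h0 hdl hj0 hjd m1 m2 (by push_cast at *; linarith)
        (by push_cast at *; linarith)
  rw [hQP] at htQ
  have := (hX ε i hi0.le hid.le).2 _ htQ
  have h3 := Int.le_ceil (ε * X ε i)
  rw [← het] at h3
  refine ⟨t, ?_⟩
  rcases hε with rfl | rfl <;> push_cast at * <;> linarith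


/-- If a maximal two-dimensional lattice polygon `P ⊆ ℝ × [0, d]` of lattice width `d`
misses a lattice point on some intermediate horizontal line (its boundary contains at
most one point of `ℤ × {i}`), then `r(P) ≤ |P ∩ (ℤ × {0})| + |P ∩ (ℤ × {d})| + 2d − 4`. -/
theorem stmt4 (d : ℕ) (hd : 2 ≤ d) (P : Set (ℝ × ℝ))
    (hP : IsMaximalPolygon P) (h2 : TwoDimensional P)
    (hsub : P ⊆ strip (d : ℝ))
    (h0 : ∃ q ∈ P, q.2 = (0 : ℝ)) (hdl : ∃ q ∈ P, q.2 = (d : ℝ))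
    (hlw : LatticeWidthIs P d)
    (hmiss : ∃ i : ℕ, 1 ≤ i ∧ i ≤ d - 1 ∧
      {x : ℤ | ((x : ℝ), (i : ℝ)) ∈ frontier P}.ncard ≤ 1) :
    boundaryLatticeCount P ≤
      {x : ℤ | ((x : ℝ), (0 : ℝ)) ∈ P}.ncard +
        {x : ℤ | ((x : ℝ), (d : ℝ)) ∈ P}.ncard + 2 * d - 4 := by
  obtain ⟨i, hi1, hid, hmi⟩ := hmiss
  have hP' := hP
  obtain ⟨⟨S, hSne, hPS⟩, -⟩ := hP'
  have hc : Convex ℝ P := by rw [hPS]; exact convex_convexHull _ _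
  have hcomp : IsCompact P := by
    rw [hPS]; exact Set.Finite.isCompact_convexHull (𝕜 := ℝ) (S.finite_toSet.image _)
  have hcl := hcomp.isClosed
  have hfr : frontier P = P \ interior P := hcl.frontier_eq
  have hSP : ∀ p ∈ S, latticeEmbed p ∈ P := fun p hp => by
    rw [hPS]; exact subset_convexHull _ _ ⟨p, hp, rfl⟩
  -- rows are nonempty
  have hrow : ∀ j : ℤ, 0 ≤ j → j ≤ d → ∃ x : ℝ, (x, (j:ℝ)) ∈ P := by
    intro j hj0 hjd
    obtain ⟨⟨q, q'⟩, hq, hq0⟩ := h0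
    obtain ⟨⟨r, r'⟩, hr, hr0⟩ := hdl
    simp only at hq0 hr0
    subst hq0 hr0
    have hdpos : (0:ℝ) < d := by exact_mod_cast (by omega : 0 < d)
    have hj0' : (0:ℝ) ≤ j := by exact_mod_cast hj0
    have hjd' : (j:ℝ) ≤ d := by exact_mod_cast hjd
    have := hc hq hr (a := 1 - j / d) (b := j / d)
      (by rw [sub_nonneg, div_le_one hdpos]; exact hjd') (by positivity) (by ring)
    simp only [Prod.smul_mk, Prod.mk_add_mk, smul_eq_mul, mul_zero, zero_add,
      div_mul_cancel₀ _ hdpos.ne'] at this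
    exact ⟨_, this⟩
  have hexX : ∀ ε j : ℤ, ∃ x : ℝ, 0 ≤ j → j ≤ d → (x, (j:ℝ)) ∈ P ∧
      ∀ x', (x', (j:ℝ)) ∈ P → ε * x' ≤ ε * x := by
    intro ε j
    by_cases hj : 0 ≤ j ∧ j ≤ d
    · obtain ⟨x0, hx0⟩ := hrow j hj.1 hj.2
      have hK : IsCompact (P ∩ {q | q.2 = (j:ℝ)}) :=
        hcomp.inter_right (isClosed_eq continuous_snd continuous_const)
      obtain ⟨⟨a, b⟩, ⟨hq, hqj⟩, hm⟩ := hK.exists_isMaxOn ⟨_, hx0, rfl⟩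
        (f := fun q : ℝ × ℝ => (ε : ℝ) * q.1) (by fun_prop)
      simp only [mem_ofPred_eq] at hqj
      subst hqj
      exact ⟨a, fun _ _ => ⟨hq, fun x' hx' => hm ⟨hx', rfl⟩⟩⟩
    · exact ⟨0, fun a b => absurd ⟨a, b⟩ hj⟩
  choose X hX using hexX
  have hmem : ∀ {j : ℤ} {x x1 x2 : ℝ}, 0 < j → j < d → (x1, (j:ℝ)) ∈ P → (x2, (j:ℝ)) ∈ P →
      x1 < x → x < x2 → (x, (j:ℝ)) ∈ interior P := by
    intro j x x1 x2 hj0 hjd a b c e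
    exact aux_mem_int hc h2 h0 hdl (by exact_mod_cast hj0) (by exact_mod_cast hjd) a b c e
  -- frontier in rows
  have hfrow : ∀ (j : ℤ) (x : ℝ), 0 < j → j < d → (x, (j:ℝ)) ∈ frontier P →
      x = X 1 j ∨ x = X (-1) j := by
    intro j x hj0 hjd hx
    rw [hfr] at hx
    by_contra hcon
    push Not at hcon
    obtain ⟨a1, a2⟩ := hX 1 j hj0.le hjd.le
    obtain ⟨b1, b2⟩ := hX (-1) j hj0.le hjd.le
    have a3 := a2 x hx.1
    have b3 := b2 x hx.1
    push_cast at a3 b3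
    exact hx.2 (hmem hj0 hjd b1 a1 (lt_of_le_of_ne (by linarith) hcon.2.symm)
      (lt_of_le_of_ne (by linarith) hcon.1))
  have hXfr : ∀ (ε j : ℤ), (ε = 1 ∨ ε = -1) → 0 < j → j < d → (X ε j, (j:ℝ)) ∈ frontier P := by
    intro ε j hε hj0 hjd
    obtain ⟨a1, a2⟩ := hX ε j hj0.le hjd.le
    rw [hfr]
    refine ⟨a1, fun h => ?_⟩
    obtain ⟨δ, hδ, q1, q2, -, -⟩ := aux_int h
    have c1 := a2 _ q1
    have c2 := a2 _ q2
    rcases hε with rfl | rfl <;> push_cast at * <;> linarith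
  have hlt : ∀ j : ℤ, 0 < j → j < d → X (-1) j < X 1 j := by
    intro j hj0 hjd
    have hj0' : (0:ℝ) < j := by exact_mod_cast hj0
    have hjd' : (j:ℝ) < d := by exact_mod_cast hjd
    have : ∃ z : ℝ, (z, (j:ℝ)) ∈ interior P := by
      obtain ⟨⟨z, y⟩, hz⟩ := h2
      have key : ∀ s r : ℝ, (r, s) ∈ P → (∃ a b : ℝ, 0 < a ∧ 0 ≤ b ∧ a + b = 1 ∧ a * y + b * s = j) →
          ∃ z : ℝ, (z, (j:ℝ)) ∈ interior P := by
        rintro s r hr ⟨a, b, ha, hb, hab, h⟩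
        have := hc.combo_interior_self_mem_interior hz hr ha hb hab
        simp only [Prod.smul_mk, Prod.mk_add_mk, smul_eq_mul, h] at this
        exact ⟨_, this⟩
      obtain ⟨⟨q, q'⟩, hq, hq0⟩ := h0
      obtain ⟨⟨r, r'⟩, hr, hr0⟩ := hdl
      simp only at hq0 hr0
      subst hq0 hr0
      rcases le_or_gt y j with h | h
      · refine key _ _ hr ⟨(d - j) / (d - y), (j - y) / (d - y), ?_, ?_, ?_, ?_⟩
        · apply div_pos <;> linarith
        · apply div_nonneg <;> linarith
        · have : (d:ℝ) - y ≠ 0 := by linarith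
          field_simp; ring
        · have : (d:ℝ) - y ≠ 0 := by linarith
          field_simp; ring
      · refine key _ _ hq ⟨j / y, 1 - j / y, ?_, ?_, ?_, ?_⟩
        · apply div_pos <;> linarith
        · rw [sub_nonneg, div_le_one (by linarith)]; exact h.le
        · ring
        · have : y ≠ 0 := by linarith
          field_simp; ring
    obtain ⟨z, hz⟩ := this
    obtain ⟨δ, hδ, q1, q2, -, -⟩ := aux_int hz
    have c1 := (hX 1 j hj0.le hjd.le).2 _ q1
    have c2 := (hX (-1) j hj0.le hjd.le).2 _ q2
    push_cast at c1 c2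
    linarith
  -- counts
  set c : ℤ → ℕ := fun j => {x : ℤ | ((x : ℝ), (j : ℝ)) ∈ frontier P}.ncard with hcdef
  have hsubpair : ∀ j : ℤ, 0 < j → j < d → {x : ℤ | ((x : ℝ), (j : ℝ)) ∈ frontier P} ⊆
      {⌊X 1 j⌋, ⌊X (-1) j⌋} := by
    intro j hj0 hjd x hx
    rcases hfrow j x hj0 hjd hx with h | h
    · left; rw [← h, Int.floor_intCast]
    · right; simp [← h, Int.floor_intCast]
  have hfinrow : ∀ j : ℤ, 0 < j → j < d → {x : ℤ | ((x : ℝ), (j : ℝ)) ∈ frontier P}.Finite :=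
    fun j hj0 hjd => (Set.toFinite _).subset (hsubpair j hj0 hjd)
  have hc2 : ∀ j : ℤ, 0 < j → j < d → c j ≤ 2 := fun j hj0 hjd =>
    (Set.ncard_le_ncard (hsubpair j hj0 hjd) (Set.toFinite _)).trans (by
      refine (Set.ncard_insert_le _ _).trans ?_
      rw [Set.ncard_singleton])
  have hiZ : (0:ℤ) < i ∧ (i:ℤ) < d := by omega
  -- integral ends
  have hend : ∀ ε : ℤ, (∃ u : ℤ, X ε 0 = u ∨ ε = 0) ∧ (∃ u : ℤ, X ε d = u ∨ ε = 0) := by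
    intro ε
    have hstr : ∀ p ∈ S, (0:ℝ) ≤ p.2 ∧ (p.2:ℝ) ≤ d := fun p hp => hsub (hSP p hp)
    constructor
    · obtain ⟨p, hp, hp2, hp3⟩ := aux_row S ε 1 0 (fun p hp => by linarith [(hstr p hp).1])
        (by rw [← hPS]; obtain ⟨q, hq, h⟩ := h0; exact ⟨q, hq, by linarith⟩)
      rw [← hPS] at hp3
      refine ⟨p.1, ?_⟩
      obtain ⟨a, b⟩ := hX ε 0 le_rfl (by omega)
      have h1 := hp3 _ a (by simp)
      have hpP := hSP p hp
      have h2 := b p.1 (by convert hpP using 1; simp only [latticeEmbed, Prod.mk.injEq, true_and]; push_cast; linarith)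
      have : (ε : ℝ) * X ε 0 = ε * p.1 := le_antisymm h1 h2
      rw [mul_eq_mul_left_iff] at this
      exact_mod_cast this
    · obtain ⟨p, hp, hp2, hp3⟩ := aux_row S ε (-1) (-d) (fun p hp => by linarith [(hstr p hp).2])
        (by rw [← hPS]; obtain ⟨q, hq, h⟩ := hdl; exact ⟨q, hq, by linarith⟩)
      rw [← hPS] at hp3
      refine ⟨p.1, ?_⟩
      obtain ⟨a, b⟩ := hX ε d (by omega) le_rfl
      have h1 := hp3 _ a (by simp)
      have hpP := hSP p hp
      have h2 := b p.1 (by convert hpP using 1; simp only [latticeEmbed, Prod.mk.injEq, true_and]; push_cast; linarith)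
      have : (ε : ℝ) * X ε d = ε * p.1 := le_antisymm h1 h2
      rw [mul_eq_mul_left_iff] at this
      exact_mod_cast this
  -- another missing row
  have hother : ∃ j : ℤ, 0 < j ∧ j < d ∧ j ≠ i ∧ c j ≤ 1 ∨ c i = 0 := by
    by_contra hcon
    push Not at hcon
    have hboth : ∀ ε : ℤ, (ε = 1 ∨ ε = -1) → ∃ u : ℤ, X ε i = u := by
      intro ε hε
      apply aux_core d P hP h2 hsub h0 hdl hc X hX ε hε i hiZ.1 hiZ.2
      intro j hj0 hjd hji
      rcases hj0.eq_or_lt with rfl | hj0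
      · obtain ⟨u, hu⟩ := (hend ε).1
        exact ⟨u, hu.resolve_right (by omega)⟩
      rcases hjd.eq_or_lt with hjd | hjd
      · rw [hjd]
        obtain ⟨u, hu⟩ := (hend ε).2
        exact ⟨u, hu.resolve_right (by omega)⟩
      have h2c := (hcon j).1 hj0 hjd hji
      obtain ⟨x1, x2, hx1, hx2, hne⟩ := (Set.one_lt_ncard_iff (hfinrow j hj0 hjd)).1 h2c
      have f1 := hfrow j x1 hj0 hjd hx1
      have f2 := hfrow j x2 hj0 hjd hx2
      have hne' : (x1:ℝ) ≠ x2 := by exact_mod_cast hne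
      rcases hε with rfl | rfl
      · rcases f1 with f | f
        · exact ⟨x1, f.symm⟩
        · rcases f2 with g | g
          · exact ⟨x2, g.symm⟩
          · exact absurd (f.trans g.symm) hne'
      · rcases f1 with f | f
        · rcases f2 with g | g
          · exact absurd (f.trans g.symm) hne'
          · exact ⟨x2, g.symm⟩
        · exact ⟨x1, f.symm⟩
    obtain ⟨u, hu⟩ := hboth 1 (Or.inl rfl)
    obtain ⟨v, hv⟩ := hboth (-1) (Or.inr rfl)
    have hl := hlt i hiZ.1 hiZ.2
    have hu' := hXfr 1 i (Or.inl rfl) hiZ.1 hiZ.2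
    have hv' := hXfr (-1) i (Or.inr rfl) hiZ.1 hiZ.2
    rw [hu] at hl hu'
    rw [hv] at hl hv'
    have : 1 < c i := by
      rw [hcdef]
      exact (Set.one_lt_ncard_iff (hfinrow i hiZ.1 hiZ.2)).2
        ⟨u, v, hu', hv', fun h => by subst h; exact lt_irrefl _ hl⟩
    have h3 : c i ≤ 1 := by simpa [hcdef] using hmi
    omega
  -- finiteness
  have hbd := hcomp.isBounded
  obtain ⟨M, hM⟩ := hbd.exists_norm_le
  have hfinP : {p : ℤ × ℤ | latticeEmbed p ∈ P}.Finite := by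
    apply (Set.finite_Icc ((-⌈M⌉, -⌈M⌉) : ℤ × ℤ) (⌈M⌉, ⌈M⌉)).subset
    intro p hp
    have := hM _ hp
    rw [Prod.norm_def, max_le_iff] at this
    simp only [latticeEmbed, Real.norm_eq_abs, abs_le] at this
    have hc := Int.le_ceil M
    refine ⟨⟨?_, ?_⟩, ⟨?_, ?_⟩⟩ <;> simp only
    · have : ((-⌈M⌉ : ℤ) : ℝ) ≤ p.1 := by push_cast; linarith [this.1.1]
      exact_mod_cast this
    · have : ((-⌈M⌉ : ℤ) : ℝ) ≤ p.2 := by push_cast; linarith [this.2.1]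
      exact_mod_cast this
    · have : (p.1:ℝ) ≤ ⌈M⌉ := by linarith [this.1.2]
      exact_mod_cast this
    · have : (p.2:ℝ) ≤ ⌈M⌉ := by linarith [this.2.2]
      exact_mod_cast this
  have hfrP : frontier P ⊆ P := hcl.frontier_subset
  have hfinF : {p : ℤ × ℤ | latticeEmbed p ∈ frontier P}.Finite := hfinP.subset (fun p hp => hfrP hp)
  have hfinR : ∀ j : ℤ, {x : ℤ | ((x:ℝ), (j:ℝ)) ∈ P}.Finite := by
    intro j
    exact (hfinP.preimage (f := fun x : ℤ => (x, j)) (by intro a _ b _ h; simpa using h))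
  have hsum : boundaryLatticeCount P = ∑ j ∈ Finset.Icc (0:ℤ) d, c j := by
    rw [boundaryLatticeCount, Set.ncard_eq_toFinset_card _ hfinF,
      Finset.card_eq_sum_card_fiberwise (f := fun p : ℤ × ℤ => p.2) (t := Finset.Icc (0:ℤ) d)]
    · apply Finset.sum_congr rfl
      intro j hj
      rw [hcdef]
      simp only
      rw [← Set.ncard_coe_finset]
      symm
      apply Set.ncard_congr (fun x _ => (x, j))
      · intro x hx
        simpa [latticeEmbed] using hx
      · intro a b _ _ h; simpa using h
      · rintro ⟨x, k⟩ hb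
        simp only [Finset.coe_filter, Set.Finite.mem_toFinset, mem_ofPred_eq] at hb
        obtain ⟨hb, rfl⟩ := hb
        exact ⟨x, hb, rfl⟩
    · intro p hp
      simp only [Finset.mem_coe, Set.Finite.mem_toFinset, mem_ofPred_eq] at hp
      have := hsub (hfrP hp)
      simp only [strip, latticeEmbed, mem_ofPred_eq] at this
      simp only [Finset.coe_Icc, mem_Icc]
      exact ⟨by exact_mod_cast this.1, by exact_mod_cast this.2⟩
  have hce0 : c 0 ≤ {x : ℤ | ((x : ℝ), (0 : ℝ)) ∈ P}.ncard := by
    rw [hcdef]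
    apply Set.ncard_le_ncard
    · intro x hx; simpa using hfrP hx
    · simpa using hfinR 0
  have hced : c d ≤ {x : ℤ | ((x : ℝ), (d : ℝ)) ∈ P}.ncard := by
    rw [hcdef]
    apply Set.ncard_le_ncard
    · intro x hx; simpa using hfrP hx
    · simpa using hfinR d
  have hsplit : ∑ j ∈ Finset.Icc (0:ℤ) d, c j = c 0 + c d + ∑ j ∈ Finset.Ioo (0:ℤ) d, c j := by
    rw [← Finset.Ioc_insert_left (by omega), Finset.sum_insert (by simp),
      ← Finset.Ioo_insert_right (by omega), Finset.sum_insert (by simp)]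
    ring
  have hci : c i ≤ 1 := by simpa [hcdef] using hmi
  have himem : (i:ℤ) ∈ Finset.Ioo (0:ℤ) d := Finset.mem_Ioo.2 hiZ
  have hcard : (Finset.Ioo (0:ℤ) d).card = d - 1 := by simp
  have hmid : ∑ j ∈ Finset.Ioo (0:ℤ) d, c j ≤ 2 * d - 4 := by
    rw [← Finset.add_sum_erase _ _ himem]
    have hcard1 : ((Finset.Ioo (0:ℤ) d).erase i).card = d - 2 := by
      rw [Finset.card_erase_of_mem himem, hcard]; omega
    have hbnd : ∀ j ∈ (Finset.Ioo (0:ℤ) d).erase i, c j ≤ 2 := by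
      intro j hj
      have := Finset.mem_Ioo.1 (Finset.mem_of_mem_erase hj)
      exact hc2 j this.1 this.2
    obtain ⟨j, ⟨hj0, hjd, hji, hcj⟩ | hci0⟩ := hother
    · have hjm : j ∈ (Finset.Ioo (0:ℤ) d).erase i :=
        Finset.mem_erase.2 ⟨hji, Finset.mem_Ioo.2 ⟨hj0, hjd⟩⟩
      rw [← Finset.add_sum_erase _ _ hjm]
      have h1 : ∑ x ∈ ((Finset.Ioo (0:ℤ) d).erase i).erase j, c x ≤ _ := Finset.sum_le_card_nsmul (((Finset.Ioo (0:ℤ) d).erase i).erase j) c 2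
        (fun k hk => hbnd k (Finset.mem_of_mem_erase hk))
      rw [Finset.card_erase_of_mem hjm, hcard1, smul_eq_mul] at h1
      have : 0 < d - 2 := by rw [← hcard1]; exact Finset.card_pos.2 ⟨j, hjm⟩
      omega
    · have h1 : ∑ x ∈ (Finset.Ioo (0:ℤ) d).erase i, c x ≤ _ := Finset.sum_le_card_nsmul ((Finset.Ioo (0:ℤ) d).erase i) c 2 hbnd
      rw [hcard1, smul_eq_mul] at h1
      omega
  rw [hsum, hsplit]
  omega
end

section
/- Let P be a maximal two-dimensional lattice polygon with g interior lattice points and lattice width d. Then d ≤ 2√(g + 2). -/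
open Set

lemma aux_halfsum (c : ℝ) (n : ℕ → ℕ) (k : ℕ)
    (H : ∀ j, 1 ≤ j → j ≤ k → c * j ≤ n j + 1) :
    c * (k * (k + 1) / 2) - k ≤ ((∑ j ∈ Finset.range k, n (j + 1) : ℕ) : ℝ) := by
  induction k with
  | zero => simp
  | succ k ih =>
    rw [Finset.sum_range_succ]
    have h1 := ih (fun j h1 h2 => H j h1 (by omega))
    have h2 := H (k + 1) (by omega) le_rfl
    push_cast at *
    nlinarith

lemma aux_endsum (n : ℕ → ℕ) (d : ℕ)
    (H : ∀ j, 1 ≤ j → j ≤ d → (3 / 4 : ℝ) * j ≤ n j + 1) :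
    (d + 1) ^ 2 ≤ 4 * ((∑ j ∈ Finset.range d, n (j + 1)) + 2) := by
  have H' : ∀ j, 1 ≤ j → j ≤ d → 3 * j ≤ 4 * n j + 4 := by
    intro j h1 h2
    have := H j h1 h2
    have h3 : (3 : ℝ) * j ≤ 4 * n j + 4 := by linarith
    exact_mod_cast h3
  clear H
  induction d with
  | zero => simp
  | succ d ih =>
    have h1 := ih (fun j h1 h2 => H' j h1 (by omega))
    rw [Finset.sum_range_succ]
    have h2 := H' (d + 1) (by omega) le_rfl
    by_cases hd : 4 ≤ d
    · nlinarith
    · have : d = 0 ∨ d = 1 ∨ d = 2 ∨ d = 3 := by omega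
      rcases this with rfl | rfl | rfl | rfl
      · simp
      · have := H' 1 (by omega) (by omega)
        simp [Finset.sum_range_succ] at *
        omega
      · have := H' 1 (by omega) (by omega)
        have := H' 2 (by omega) (by omega)
        simp [Finset.sum_range_succ] at *
        omega
      · have := H' 1 (by omega) (by omega)
        have := H' 2 (by omega) (by omega)
        have := H' 3 (by omega) (by omega)
        simp [Finset.sum_range_succ] at *
        omega

lemma aux_alg (d k h : ℝ) (h1 : 1 ≤ h) (h2 : h ≤ d - 1) (hk : k ≤ h) (hk' : h ≤ k + 1)
    (hd : 3 ≤ d) :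
    d ^ 2 / 4 - 2 ≤ (3 * d / 4 / h) * (k * (k + 1) / 2) - k
      + ((3 * d / 4 / (d - h)) * ((d - 1 - k) * (d - 1 - k + 1) / 2) - (d - 1 - k)) := by
  have hp : 0 < h := by linarith
  have hq : 0 < d - h := by linarith
  have hpq : d - 1 ≤ h * (d - h) := by nlinarith
  have hth : (h - k) * (1 - (h - k)) ≤ 1 / 4 := by nlinarith [sq_nonneg (h - k - 1 / 2)]
  have hth0 : 0 ≤ (h - k) * (1 - (h - k)) := mul_nonneg (by linarith) (by linarith)
  have key : (3 * d / 4 / h) * (k * (k + 1) / 2) - k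
      + ((3 * d / 4 / (d - h)) * ((d - 1 - k) * (d - 1 - k + 1) / 2) - (d - 1 - k))
      = 3 * d ^ 2 / 8 * (1 - (h - k) * (1 - (h - k)) / (h * (d - h))) - (d - 1) := by
    field_simp
    ring
  rw [key]
  have hle : (h - k) * (1 - (h - k)) / (h * (d - h)) ≤ 1 / (4 * (d - 1)) := by
    rw [div_le_div_iff₀ (by positivity) (by linarith)]
    nlinarith
  have h5 : 3 * d ^ 2 / 8 * (1 - 1 / (4 * (d - 1))) ≤
      3 * d ^ 2 / 8 * (1 - (h - k) * (1 - (h - k)) / (h * (d - h))) := by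
    apply mul_le_mul_of_nonneg_left _ (by positivity)
    linarith
  have h6 : d ^ 2 / 4 - 2 + (d - 1) ≤ 3 * d ^ 2 / 8 * (1 - 1 / (4 * (d - 1))) := by
    have hd1 : 0 < d - 1 := by linarith
    have : 3 * d ^ 2 / 8 * (1 - 1 / (4 * (d - 1))) - (d ^ 2 / 4 - 2 + (d - 1))
      = (12 * d ^ 2 * (d - 1) - 3 * d ^ 2 - 8 * d ^ 2 * (d - 1) + 64 * (d - 1) - 32 * (d - 1) ^ 2)
        / (32 * (d - 1)) := by
      field_simp
      ring
    have h7 : 0 ≤ (12 * d ^ 2 * (d - 1) - 3 * d ^ 2 - 8 * d ^ 2 * (d - 1) + 64 * (d - 1) - 32 * (d - 1) ^ 2)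
        / (32 * (d - 1)) := by
      apply div_nonneg _ (by linarith)
      nlinarith [mul_nonneg (sub_nonneg.2 hd) (sq_nonneg (d - 4)), sq_nonneg (d - 4), sq_nonneg (d-3)]
    linarith
  linarith

lemma aux_tent (d : ℕ) (h : ℝ) (h0 : 0 ≤ h) (hd : h ≤ d) (n : ℕ → ℕ)
    (H1 : ∀ j : ℕ, 1 ≤ j → j < d → (j : ℝ) ≤ h → (3 * d / 4 / h : ℝ) * j ≤ n j + 1)
    (H2 : ∀ j : ℕ, 1 ≤ j → j < d → h ≤ j → (3 * d / 4 / (d - h) : ℝ) * (d - j) ≤ n j + 1) :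
    d ^ 2 ≤ 4 * ((∑ j ∈ Finset.range (d - 1), n (j + 1)) + 2) := by
  by_cases hd3 : d < 3
  · interval_cases d <;> omega
  obtain ⟨e, rfl⟩ : ∃ e, d = e + 1 := ⟨d - 1, by omega⟩
  have he : (2 : ℝ) ≤ e := by
    have : 2 ≤ e := by omega
    exact_mod_cast this
  simp only [Nat.add_sub_cancel]
  push_cast at *
  by_cases hlo : h < 1
  · have := aux_endsum (fun j => n (e + 1 - j)) e (by
      intro j hj1 hj2
      have h3 : h ≤ ((e + 1 - j : ℕ) : ℝ) := by
        have : (1 : ℝ) ≤ ((e + 1 - j : ℕ) : ℝ) := by exact_mod_cast (by omega : 1 ≤ e + 1 - j)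
        linarith
      have := H2 (e + 1 - j) (by omega) (by omega) h3
      refine le_trans ?_ this
      rw [Nat.cast_sub (by omega)]
      push_cast
      have : (3 / 4 : ℝ) ≤ 3 * (e + 1) / 4 / (e + 1 - h) := by
        rw [le_div_iff₀ (by linarith)]
        linarith
      have hj : (0 : ℝ) ≤ j := by positivity
      nlinarith)
    have hr := Finset.sum_range_reflect (fun j => n (j + 1)) e
    have : ∑ j ∈ Finset.range e, n (e + 1 - (j + 1)) = ∑ j ∈ Finset.range e, n (j + 1) := by
      rw [← hr]
      apply Finset.sum_congr rfl
      intro j hj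
      have := Finset.mem_range.1 hj
      congr 1
      omega
    rw [← this]
    assumption
  by_cases hhi : (e : ℝ) < h
  · apply aux_endsum n e
    intro j hj1 hj2
    have hje : (j : ℝ) ≤ e := by exact_mod_cast hj2
    refine le_trans ?_ (H1 j hj1 (by omega) (by linarith))
    have : (3 / 4 : ℝ) ≤ 3 * (e + 1) / 4 / h := by
      rw [le_div_iff₀ (by linarith)]
      linarith
    have hj : (0 : ℝ) ≤ j := by positivity
    nlinarith
  push Not at hlo hhi
  obtain ⟨k, hk⟩ : ∃ k, k = ⌊h⌋₊ := ⟨_, rfl⟩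
  have hk1 : (k : ℝ) ≤ h := by rw [hk]; exact Nat.floor_le h0
  have hk2 : h < k + 1 := by rw [hk]; exact Nat.lt_floor_add_one h
  have hke : k ≤ e := by exact_mod_cast hk1.trans hhi
  have s1 := aux_halfsum (3 * (e + 1) / 4 / h) n k (by
    intro j hj1 hj2
    have : (j : ℝ) ≤ k := by exact_mod_cast hj2
    exact H1 j hj1 (by omega) (by linarith))
  have s2 := aux_halfsum (3 * (e + 1) / 4 / (e + 1 - h)) (fun j => n (e + 1 - j)) (e - k) (by
    intro j hj1 hj2
    have h3 : h ≤ ((e + 1 - j : ℕ) : ℝ) := by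
      have : (k + 1 : ℝ) ≤ ((e + 1 - j : ℕ) : ℝ) := by exact_mod_cast (by omega : k + 1 ≤ e + 1 - j)
      linarith
    have := H2 (e + 1 - j) (by omega) (by omega) h3
    refine le_trans (le_of_eq ?_) this
    rw [Nat.cast_sub (by omega)]
    push_cast
    ring)
  have hsum : ∑ j ∈ Finset.range e, n (j + 1) = ∑ j ∈ Finset.range k, n (j + 1)
      + ∑ j ∈ Finset.range (e - k), n (e + 1 - (j + 1)) := by
    have hr := Finset.sum_range_reflect (fun j => n (k + j + 1)) (e - k)
    have h4 : ∑ j ∈ Finset.range (e - k), n (e + 1 - (j + 1))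
        = ∑ j ∈ Finset.range (e - k), n (k + j + 1) := by
      rw [← hr]
      apply Finset.sum_congr rfl
      intro j hj
      have := Finset.mem_range.1 hj
      congr 1
      omega
    rw [h4]
    obtain ⟨m, rfl⟩ : ∃ m, e = k + m := ⟨e - k, by omega⟩
    rw [Finset.sum_range_add]
    simp
  have alg := aux_alg (e + 1) k h hlo (by linarith) hk1 hk2.le (by linarith)
  rw [Nat.cast_sub hke] at s2
  have e1 : (e : ℝ) + 1 - 1 - k = e - k := by ring
  rw [e1] at alg
  have : ((e + 1 : ℕ) : ℝ) ^ 2 ≤ 4 * (((∑ j ∈ Finset.range e, n (j + 1) : ℕ) : ℝ) + 2) := by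
    rw [hsum]
    push_cast at *
    linarith
  exact_mod_cast this


lemma aux_interior {P : Set (ℝ × ℝ)} (hc : Convex ℝ P) (hi : (interior P).Nonempty)
    {L R x y t0 t1 y0 y1 : ℝ} (hL : (L, y) ∈ P) (hR : (R, y) ∈ P) (h0 : (t0, y0) ∈ P)
    (h1 : (t1, y1) ∈ P) (hLx : L < x) (hxR : x < R) (hy0 : y0 < y) (hy1 : y < y1) :
    (x, y) ∈ interior P := by
  by_contra hn
  obtain ⟨f, hf⟩ := geometric_hahn_banach_open_point hc.interior isOpen_interior hn
  have hf' : ∀ a ∈ P, f a ≤ f (x, y) := by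
    intro a ha
    have hcl : a ∈ closure (interior P) := by
      rw [hc.closure_interior_eq_closure_of_nonempty_interior hi]
      exact subset_closure ha
    have hcl2 : IsClosed {a | f a ≤ f (x, y)} := isClosed_le f.continuous continuous_const
    exact hcl2.closure_subset_iff.2 (fun b hb => (hf b hb).le) hcl
  have hlin : ∀ a b : ℝ, f (a, b) = a * f (1, 0) + b * f (0, 1) := by
    intro a b
    have : ((a, b) : ℝ × ℝ) = a • ((1, 0) : ℝ × ℝ) + b • ((0, 1) : ℝ × ℝ) := by simp
    rw [this, map_add, map_smul, map_smul]
    simp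
  have a1 := hf' _ hL
  have a2 := hf' _ hR
  have a3 := hf' _ h0
  have a4 := hf' _ h1
  rw [hlin, hlin x y] at a1 a2 a3 a4
  have e1 : f (1, 0) = 0 := by
    apply le_antisymm
    · by_contra hh
      push Not at hh
      nlinarith
    · by_contra hh
      push Not at hh
      nlinarith
  have e2 : f (0, 1) = 0 := by
    rw [e1] at a3 a4
    apply le_antisymm
    · by_contra hh
      push Not at hh
      nlinarith
    · by_contra hh
      push Not at hh
      nlinarith
  obtain ⟨q, hq⟩ := hi
  have := hf q hq
  rw [show q = (q.1, q.2) from rfl, hlin, hlin x y, e1, e2] at this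
  simp at this

lemma aux_finite {P : Set (ℝ × ℝ)} (hP : IsLatticePolygon P) :
    (interiorLatticePoints P).Finite := by
  obtain ⟨S, -, rfl⟩ := hP
  have hb : Bornology.IsBounded (convexHull ℝ (latticeEmbed '' (S : Set (ℤ × ℤ)))) :=
    ((S.finite_toSet.image _).isCompact_convexHull (𝕜 := ℝ)).isBounded
  obtain ⟨r, hr⟩ := hb.subset_closedBall 0
  apply Set.Finite.subset (Set.finite_Icc ((-⌈r⌉, -⌈r⌉) : ℤ × ℤ) (⌈r⌉, ⌈r⌉))
  intro p hp
  have h1 := hr (interior_subset hp)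
  rw [mem_closedBall_zero_iff, Prod.norm_def, sup_le_iff, Real.norm_eq_abs, Real.norm_eq_abs,
    abs_le, abs_le] at h1
  simp only [latticeEmbed] at h1
  have hc := Int.le_ceil r
  obtain ⟨⟨a, b⟩, c, e⟩ := h1
  refine ⟨⟨?_, ?_⟩, ⟨?_, ?_⟩⟩
  all_goals
    have : ∀ m : ℤ, ((m : ℤ) : ℝ) ≤ (⌈r⌉ : ℤ) → m ≤ ⌈r⌉ := fun m hm => by exact_mod_cast hm
    simp only
  · have := this (-p.1) (by push_cast; linarith)
    linarith
  · have := this (-p.2) (by push_cast; linarith)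
    linarith
  · exact this _ (by linarith)
  · exact this _ (by linarith)

/-- Row count. -/
lemma aux_row_s5 {P : Set (ℝ × ℝ)} (hc : Convex ℝ P) (hi : (interior P).Nonempty)
    (hf : (interiorLatticePoints P).Finite)
    {L R t0 t1 y0 y1 : ℝ} {j : ℤ} (hL : (L, (j : ℝ)) ∈ P) (hR : (R, (j : ℝ)) ∈ P)
    (h0 : (t0, y0) ∈ P) (h1 : (t1, y1) ∈ P) (hy0 : y0 < j) (hy1 : j < y1) :
    R - L ≤ ((hf.toFinset.filter (fun p => p.2 = j)).card : ℝ) + 1 := by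
  have hsub : (Finset.Ioo ⌊L⌋ ⌈R⌉).image (fun i => (i, j)) ⊆
      hf.toFinset.filter (fun p => p.2 = j) := by
    intro p hp
    simp only [Finset.mem_image, Finset.mem_Ioo] at hp
    obtain ⟨i, ⟨hi1, hi2⟩, rfl⟩ := hp
    simp only [Finset.mem_filter, Set.Finite.mem_toFinset, and_true]
    exact aux_interior hc hi hL hR h0 h1 (Int.floor_lt.1 hi1) (Int.lt_ceil.1 hi2) hy0 hy1
  have hcard := Finset.card_le_card hsub
  rw [Finset.card_image_of_injective _ (by intro a b hab; simpa using hab), Int.card_Ioo] at hcard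
  have h5 : ⌈R⌉ - ⌊L⌋ - 1 ≤ ((hf.toFinset.filter (fun p => p.2 = j)).card : ℤ) := by omega
  have h6 : ((⌈R⌉ : ℝ) - ⌊L⌋ - 1) ≤ ((hf.toFinset.filter (fun p => p.2 = j)).card : ℝ) := by
    exact_mod_cast h5
  have := Int.le_ceil R
  have := Int.floor_le L
  linarith

/-- Counting in a window of height `d` starting at height `c`. -/
lemma aux_count {P : Set (ℝ × ℝ)} (hP : IsLatticePolygon P) (hi : (interior P).Nonempty)
    (d : ℕ) (c : ℤ) (t0 t1 xl xr h : ℝ) (h0 : (t0, (c : ℝ)) ∈ P) (h1 : (t1, (c : ℝ) + d) ∈ P)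
    (hl : (xl, h) ∈ P) (hr : (xr, h) ∈ P) (hch : c ≤ h) (hhc : h ≤ c + d)
    (hM : 3 * d / 4 ≤ xr - xl) : d ^ 2 ≤ 4 * (polygonGenus P + 2) := by
  have hf := aux_finite hP
  have hc : Convex ℝ P := by
    obtain ⟨S, -, rfl⟩ := hP
    exact convex_convexHull ℝ _
  set n : ℕ → ℕ := fun j => (hf.toFinset.filter (fun p => p.2 = c + (j : ℤ))).card with hn
  have hsum : ∑ j ∈ Finset.range (d - 1), n (j + 1) ≤ polygonGenus P := by
    unfold polygonGenus
    rw [Set.ncard_eq_toFinset_card _ hf]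
    rw [hn]
    rw [← Finset.card_biUnion]
    · apply Finset.card_le_card
      intro p hp
      simp only [Finset.mem_biUnion, Finset.mem_filter] at hp
      obtain ⟨_, _, h, _⟩ := hp
      exact h
    · intro a _ b _ hab
      rw [Function.onFun, Finset.disjoint_left]
      intro p hp hq
      simp only [Finset.mem_filter] at hp hq
      apply hab
      have := hp.2.symm.trans hq.2
      push_cast at this
      omega
  have key : d ^ 2 ≤ 4 * ((∑ j ∈ Finset.range (d - 1), n (j + 1)) + 2) := by
    apply aux_tent d (h - c) (by linarith) (by linarith)
    · intro j hj1 hjd hjh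
      have hj1' : (1 : ℝ) ≤ j := by exact_mod_cast hj1
      have hjd' : (j : ℝ) < d := by exact_mod_cast hjd
      have hh : 0 < h - c := by linarith
      have hw : (j : ℝ) / (h - c) ≤ 1 := (div_le_one hh).2 hjh
      have hw0 : 0 ≤ (j : ℝ) / (h - c) := by positivity
      have hy : (1 - j / (h - c)) * c + j / (h - c) * h = ((c + (j : ℤ) : ℤ) : ℝ) := by
        push_cast
        field_simp
        ring
      have m1 := hc h0 hl (sub_nonneg.2 hw) hw0 (by ring)
      have m2 := hc h0 hr (sub_nonneg.2 hw) hw0 (by ring)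
      simp only [Prod.smul_mk, Prod.mk_add_mk, smul_eq_mul] at m1 m2
      rw [hy] at m1 m2
      have := aux_row_s5 hc hi hf m1 m2 h0 h1 (by push_cast; linarith) (by push_cast; linarith)
      refine le_trans ?_ this
      have e : (3 * d / 4 / (h - c) : ℝ) * j = j / (h - c) * (3 * d / 4) := by ring
      rw [e]
      have := mul_le_mul_of_nonneg_left hM hw0
      linarith
    · intro j hj1 hjd hjh
      have hj1' : (1 : ℝ) ≤ j := by exact_mod_cast hj1
      have hjd' : (j : ℝ) < d := by exact_mod_cast hjd
      have hh : 0 < d - (h - c) := by linarith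
      have hw : (d - j : ℝ) / (d - (h - c)) ≤ 1 := (div_le_one hh).2 (by linarith)
      have hw0 : 0 ≤ (d - j : ℝ) / (d - (h - c)) := div_nonneg (by linarith) hh.le
      have hy : (1 - (d - j : ℝ) / (d - (h - c))) * (c + d) + (d - j : ℝ) / (d - (h - c)) * h
          = ((c + (j : ℤ) : ℤ) : ℝ) := by
        push_cast
        field_simp
        ring
      have m1 := hc h1 hl (sub_nonneg.2 hw) hw0 (by ring)
      have m2 := hc h1 hr (sub_nonneg.2 hw) hw0 (by ring)
      simp only [Prod.smul_mk, Prod.mk_add_mk, smul_eq_mul] at m1 m2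
      rw [hy] at m1 m2
      have := aux_row_s5 hc hi hf m1 m2 h0 h1 (by push_cast; linarith) (by push_cast; linarith)
      refine le_trans ?_ this
      have e : (3 * d / 4 / (d - (h - c)) : ℝ) * (d - j) = (d - j) / (d - (h - c)) * (3 * d / 4) := by
        ring
      rw [e]
      have := mul_le_mul_of_nonneg_left hM hw0
      linarith
  omega

lemma aux_extreme {P : Set (ℝ × ℝ)} (hP : IsLatticePolygon P) (γ δ : ℤ) :
    ∃ p q : ℤ × ℤ, latticeEmbed p ∈ P ∧ latticeEmbed q ∈ P ∧ ∀ r ∈ P,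
      (γ * q.1 + δ * q.2 : ℝ) ≤ γ * r.1 + δ * r.2 ∧
      (γ * r.1 + δ * r.2 : ℝ) ≤ γ * p.1 + δ * p.2 := by
  obtain ⟨S, hS, rfl⟩ := hP
  obtain ⟨p, hp, hp'⟩ := S.exists_max_image (fun p => γ * p.1 + δ * p.2) hS
  obtain ⟨q, hq, hq'⟩ := S.exists_min_image (fun p => γ * p.1 + δ * p.2) hS
  refine ⟨p, q, subset_convexHull ℝ _ ⟨p, hp, rfl⟩, subset_convexHull ℝ _ ⟨q, hq, rfl⟩, ?_⟩
  have hconv : Convex ℝ {r : ℝ × ℝ | (γ * q.1 + δ * q.2 : ℝ) ≤ γ * r.1 + δ * r.2 ∧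
      (γ * r.1 + δ * r.2 : ℝ) ≤ γ * p.1 + δ * p.2} := by
    intro u hu v hv a b ha hb hab
    simp only [Set.mem_ofPred_eq, Prod.fst_add, Prod.snd_add, Prod.smul_fst, Prod.smul_snd,
      smul_eq_mul] at *
    have hb' : b = 1 - a := by linarith
    subst hb'
    constructor <;> nlinarith
  intro r hr
  apply convexHull_min _ hconv hr
  rintro _ ⟨s, hs, rfl⟩
  have a1 := hp' s hs
  have a2 := hq' s hs
  simp only [latticeEmbed, Set.mem_ofPred_eq]
  exact ⟨by exact_mod_cast a2, by exact_mod_cast a1⟩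


lemma aux_zinv {φ : ℝ × ℝ → ℝ × ℝ} (h : IsZAffine φ) :
    ∃ ψ, IsZAffine ψ ∧ (∀ p, ψ (φ p) = p) ∧ (∀ p, φ (ψ p) = p) := by
  obtain ⟨a, b, c, d, e, f, hdet, hφ⟩ := h
  obtain ⟨ε, hε, hε2⟩ : ∃ ε : ℤ, a * d - b * c = ε ∧ ε * ε = 1 := by
    rcases hdet with h | h
    · exact ⟨1, h, by norm_num⟩
    · exact ⟨-1, h, by norm_num⟩
  have hdr : (a * d - b * c : ℝ) = ε := by exact_mod_cast hε
  have her : (ε * ε : ℝ) = 1 := by exact_mod_cast hε2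
  refine ⟨fun p => ((ε * d : ℤ) * p.1 + (-ε * b : ℤ) * p.2 + (-(ε * d * e) + ε * b * f : ℤ),
    (-ε * c : ℤ) * p.1 + (ε * a : ℤ) * p.2 + (ε * c * e - ε * a * f : ℤ)),
    ⟨ε * d, -ε * b, -ε * c, ε * a, _, _, ?_, fun p => rfl⟩, ?_, ?_⟩
  · have : ε * d * (ε * a) - -ε * b * (-ε * c) = (ε * ε) * (a * d - b * c) := by ring
    rw [this, hε2, one_mul]
    exact hdet
  · intro p
    rw [hφ p]
    ext
    · push_cast
      linear_combination (ε * p.1 : ℝ) * hdr + p.1 * her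
    · push_cast
      linear_combination (ε * p.2 : ℝ) * hdr + p.2 * her
  · intro p
    rw [hφ]
    ext
    · push_cast
      linear_combination (ε * (p.1 - e) : ℝ) * hdr + (p.1 - e) * her
    · push_cast
      linear_combination (ε * (p.2 - f) : ℝ) * hdr + (p.2 - f) * her

lemma aux_zcomp {φ ψ : ℝ × ℝ → ℝ × ℝ} (h : IsZAffine φ) (h' : IsZAffine ψ) :
    IsZAffine (fun p => φ (ψ p)) := by
  obtain ⟨a, b, c, d, e, f, hdet, hφ⟩ := h
  obtain ⟨a', b', c', d', e', f', hdet', hψ⟩ := h'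
  refine ⟨a * a' + b * c', a * b' + b * d', c * a' + d * c', c * b' + d * d',
    a * e' + b * f' + e, c * e' + d * f' + f, ?_, ?_⟩
  · have : (a * a' + b * c') * (c * b' + d * d') - (a * b' + b * d') * (c * a' + d * c')
      = (a * d - b * c) * (a' * d' - b' * c') := by ring
    rw [this]
    rcases hdet with h | h <;> rcases hdet' with h' | h' <;> rw [h, h'] <;> norm_num
  · intro p
    simp only [hψ, hφ]
    push_cast
    ext <;> simp only <;> ring

lemma aux_zcont {φ : ℝ × ℝ → ℝ × ℝ} (h : IsZAffine φ) : Continuous φ := by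
  obtain ⟨a, b, c, d, e, f, hdet, hφ⟩ := h
  rw [funext hφ]
  fun_prop

lemma aux_zlat {φ : ℝ × ℝ → ℝ × ℝ} (h : IsZAffine φ) :
    ∃ F : ℤ × ℤ → ℤ × ℤ, ∀ p, φ (latticeEmbed p) = latticeEmbed (F p) := by
  obtain ⟨a, b, c, d, e, f, hdet, hφ⟩ := h
  refine ⟨fun p => (a * p.1 + b * p.2 + e, c * p.1 + d * p.2 + f), fun p => ?_⟩
  rw [hφ]
  simp [latticeEmbed]

lemma aux_embed_inj : Function.Injective latticeEmbed := by
  intro p q h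
  simp only [latticeEmbed, Prod.mk.injEq, Int.cast_inj] at h
  exact Prod.ext h.1 h.2

lemma aux_zinterior {φ : ℝ × ℝ → ℝ × ℝ} (h : IsZAffine φ) (P : Set (ℝ × ℝ)) :
    interior (φ '' P) = φ '' interior P := by
  obtain ⟨ψ, hψ, h1, h2⟩ := aux_zinv h
  let e : (ℝ × ℝ) ≃ₜ (ℝ × ℝ) :=
    { toFun := φ, invFun := ψ, left_inv := h1, right_inv := h2,
      continuous_toFun := aux_zcont h, continuous_invFun := aux_zcont hψ }
  exact (e.image_interior P).symm

lemma aux_zgenus {φ : ℝ × ℝ → ℝ × ℝ} (h : IsZAffine φ) (P : Set (ℝ × ℝ)) :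
    polygonGenus (φ '' P) = polygonGenus P := by
  obtain ⟨ψ, hψ, h1, h2⟩ := aux_zinv h
  obtain ⟨F, hF⟩ := aux_zlat h
  obtain ⟨G, hG⟩ := aux_zlat hψ
  unfold polygonGenus
  have hFG : ∀ p, F (G p) = p := fun p => aux_embed_inj (by rw [← hF, ← hG, h2])
  have hGF : ∀ p, G (F p) = p := fun p => aux_embed_inj (by rw [← hG, ← hF, h1])
  have : interiorLatticePoints (φ '' P) = F '' interiorLatticePoints P := by
    ext p
    constructor
    · intro hp
      change latticeEmbed p ∈ interior (φ '' P) at hp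
      rw [aux_zinterior h] at hp
      obtain ⟨q, hq, hqp⟩ := hp
      refine ⟨G p, ?_, hFG p⟩
      change latticeEmbed (G p) ∈ interior P
      rw [← hG, ← hqp, h1]
      exact hq
    · rintro ⟨q, hq, rfl⟩
      change latticeEmbed (F q) ∈ interior (φ '' P)
      rw [aux_zinterior h, ← hF]
      exact ⟨_, hq, rfl⟩
  rw [this]
  exact Set.ncard_image_of_injective _ (Function.LeftInverse.injective hGF)

lemma aux_zpoly {φ : ℝ × ℝ → ℝ × ℝ} (h : IsZAffine φ) {P : Set (ℝ × ℝ)}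
    (hP : IsLatticePolygon P) : IsLatticePolygon (φ '' P) := by
  classical
  obtain ⟨F, hF⟩ := aux_zlat h
  obtain ⟨a, b, c, d, e, f, hdet, hφ⟩ := h
  obtain ⟨S, hS, rfl⟩ := hP
  refine ⟨S.image F, hS.image F, ?_⟩
  let l : ℝ × ℝ →ₗ[ℝ] ℝ × ℝ :=
    { toFun := fun p => ((a : ℝ) * p.1 + (b : ℝ) * p.2, (c : ℝ) * p.1 + (d : ℝ) * p.2)
      map_add' := by
        intro p q
        ext <;> simp <;> ring
      map_smul' := by
        intro t p
        ext <;> simp <;> ring }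
  let A : ℝ × ℝ →ᵃ[ℝ] ℝ × ℝ :=
    { toFun := φ
      linear := l
      map_vadd' := by
        intro p v
        rw [hφ, hφ]
        ext <;> simp [l] <;> ring }
  have := A.image_convexHull (latticeEmbed '' (S : Set (ℤ × ℤ)))
  have hA : (A : ℝ × ℝ → ℝ × ℝ) = φ := rfl
  rw [hA] at this
  rw [this]
  congr 1
  rw [Finset.coe_image, Set.image_image, Set.image_image]
  exact Set.image_congr (fun p _ => hF p)

def AuxGood (P : Set (ℝ × ℝ)) (d : ℕ) : Prop :=
  IsLatticePolygon P ∧ TwoDimensional P ∧ LatticeWidthIs P d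

lemma aux_zgood {φ : ℝ × ℝ → ℝ × ℝ} (h : IsZAffine φ) {P : Set (ℝ × ℝ)} {d : ℕ}
    (hP : AuxGood P d) : AuxGood (φ '' P) d := by
  obtain ⟨h1, h2, h3⟩ := hP
  refine ⟨aux_zpoly h h1, ?_, ?_⟩
  · unfold TwoDimensional
    rw [aux_zinterior h]
    exact Set.Nonempty.image _ h2
  · obtain ⟨ψ, hψ, i1, i2⟩ := aux_zinv h
    refine ⟨⟨h3.1.1, ?_⟩, ?_⟩
    · obtain ⟨χ, hχ, hs⟩ := h3.1.2
      refine ⟨_, aux_zcomp hχ hψ, ?_⟩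
      rintro _ ⟨_, ⟨p, hp, rfl⟩, rfl⟩
      simp only [i1]
      exact hs ⟨p, hp, rfl⟩
    · rintro s ⟨hs, χ, hχ, hs2⟩
      apply h3.2
      refine ⟨hs, _, aux_zcomp hχ h, ?_⟩
      rintro _ ⟨p, hp, rfl⟩
      exact hs2 ⟨_, ⟨p, hp, rfl⟩, rfl⟩

lemma aux_width {P : Set (ℝ × ℝ)} {d : ℕ} (hP : AuxGood P d) (α β γ δ : ℤ)
    (hdet : α * δ - β * γ = 1 ∨ α * δ - β * γ = -1) :
    ∃ p q : ℤ × ℤ, latticeEmbed p ∈ P ∧ latticeEmbed q ∈ P ∧ (∀ r ∈ P,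
      (γ * q.1 + δ * q.2 : ℝ) ≤ γ * r.1 + δ * r.2 ∧
      (γ * r.1 + δ * r.2 : ℝ) ≤ γ * p.1 + δ * p.2) ∧
      (d : ℝ) ≤ (γ * p.1 + δ * p.2) - (γ * q.1 + δ * q.2) := by
  obtain ⟨h1, h2, h3⟩ := hP
  obtain ⟨p, q, hp, hq, hr⟩ := aux_extreme h1 γ δ
  refine ⟨p, q, hp, hq, hr, ?_⟩
  have hpos : (0 : ℝ) < (γ * p.1 + δ * p.2) - (γ * q.1 + δ * q.2) := by
    obtain ⟨x, hx⟩ := h2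
    have hcont : Continuous (fun t : ℝ => x + t • ((γ : ℝ), (δ : ℝ))) := by fun_prop
    have hev : ∀ᶠ t in nhds (0 : ℝ), x + t • ((γ : ℝ), (δ : ℝ)) ∈ interior P := by
      apply hcont.continuousAt.eventually_mem
      apply isOpen_interior.mem_nhds
      simpa using hx
    obtain ⟨t, ht, ht0⟩ := ((hev.filter_mono nhdsWithin_le_nhds).and
      (self_mem_nhdsWithin : Set.Ioi (0 : ℝ) ∈ nhdsWithin 0 (Set.Ioi 0))).exists
    have a1 := (hr _ (interior_subset ht)).2
    have a2 := (hr _ (interior_subset hx)).1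
    simp only [Prod.fst_add, Prod.snd_add, Prod.smul_fst, Prod.smul_snd, smul_eq_mul] at a1
    have ht0' : (0 : ℝ) < t := ht0
    have hg : (0 : ℝ) < γ * γ + δ * δ := by
      have : 0 < γ * γ + δ * δ := by
        by_contra hh
        have e1 : γ = 0 := by nlinarith
        have e2 : δ = 0 := by nlinarith
        rw [e1, e2] at hdet
        simp at hdet
      exact_mod_cast this
    have := mul_pos ht0' hg
    linarith
  obtain ⟨w, hw⟩ : ∃ w : ℤ, w = (γ * p.1 + δ * p.2) - (γ * q.1 + δ * q.2) := ⟨_, rfl⟩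
  have hwr : (w : ℝ) = (γ * p.1 + δ * p.2) - (γ * q.1 + δ * q.2) := by rw [hw]; push_cast; ring
  rw [← hwr] at hpos ⊢
  have hw0 : 0 < w := by exact_mod_cast hpos
  obtain ⟨s, rfl⟩ := Int.eq_ofNat_of_zero_le hw0.le
  have : d ≤ s := by
    apply h3.2
    refine ⟨by exact_mod_cast hw0, _, ⟨α, β, γ, δ, 0, -(γ * q.1 + δ * q.2), hdet, fun p => rfl⟩, ?_⟩
    rintro _ ⟨r, hr', rfl⟩
    obtain ⟨b1, b2⟩ := hr r hr'
    simp only [strip, Set.mem_ofPred_eq]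
    push_cast at *
    constructor <;> linarith
  exact_mod_cast this

lemma aux_done {P : Set (ℝ × ℝ)} {d : ℕ} (hP : AuxGood P d) {u w : ℝ × ℝ} (hu : u ∈ P) (hw : w ∈ P)
    (hy : u.2 = w.2) (hx : 3 * d / 4 ≤ u.1 - w.1) : d ^ 2 ≤ 4 * (polygonGenus P + 2) := by
  obtain ⟨p, q, hp, hq, hr, hd⟩ := aux_width hP 1 0 0 1 (by norm_num)
  simp only [Int.cast_zero, zero_mul, Int.cast_one, one_mul, zero_add] at hr hd
  have hc : Convex ℝ P := by
    obtain ⟨⟨S, -, rfl⟩, -⟩ := hP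
    exact convex_convexHull ℝ _
  have hpt : ∀ y : ℝ, (q.2 : ℝ) ≤ y → y ≤ p.2 → ∃ t, (t, y) ∈ P := by
    intro y h1 h2
    by_cases hh : (p.2 : ℝ) - q.2 = 0
    · refine ⟨q.1, ?_⟩
      have : y = q.2 := by linarith
      rw [this]
      exact hq
    · have hpos : 0 < (p.2 : ℝ) - q.2 := lt_of_le_of_ne (by linarith) (Ne.symm hh)
      have := hc hq hp (a := (p.2 - y) / (p.2 - q.2)) (b := (y - q.2) / (p.2 - q.2))
        (div_nonneg (by linarith) hpos.le) (div_nonneg (by linarith) hpos.le)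
        (by field_simp; ring)
      simp only [latticeEmbed, Prod.smul_mk, Prod.mk_add_mk, smul_eq_mul] at this
      refine ⟨((p.2 - y) / (p.2 - q.2)) * q.1 + ((y - q.2) / (p.2 - q.2)) * p.1, ?_⟩
      convert this using 2
      field_simp
      ring
  have hu2 := hr u hu
  have hu' : (u.1, u.2) ∈ P := hu
  have hw' : (w.1, u.2) ∈ P := by rw [hy]; exact hw
  by_cases hcase : u.2 ≤ q.2 + d
  · obtain ⟨t0, h0⟩ := hpt q.2 le_rfl (by linarith [(Nat.cast_nonneg d : (0 : ℝ) ≤ d)])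
    obtain ⟨t1, h1⟩ := hpt (q.2 + d) (by linarith [(Nat.cast_nonneg d : (0 : ℝ) ≤ d)]) (by linarith)
    exact aux_count hP.1 hP.2.1 d q.2 t0 t1 w.1 u.1 u.2 h0 h1 hw' hu' hu2.1 hcase hx
  · push Not at hcase
    obtain ⟨t0, h0⟩ := hpt ((p.2 - (d : ℤ) : ℤ) : ℝ) (by push_cast; linarith)
      (by push_cast; linarith [(Nat.cast_nonneg d : (0 : ℝ) ≤ d)])
    obtain ⟨t1, h1⟩ := hpt (((p.2 - (d : ℤ) : ℤ) : ℝ) + d)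
      (by push_cast; linarith [(Nat.cast_nonneg d : (0 : ℝ) ≤ d)]) (by push_cast; linarith)
    by_cases hc2 : (p.2 : ℝ) - d ≤ u.2
    · exact aux_count hP.1 hP.2.1 d _ t0 t1 w.1 u.1 u.2 h0 h1 hw' hu' (by push_cast; linarith)
        (by push_cast; linarith) hx
    · -- intermediate window
      push Not at hc2
      obtain ⟨t0, h0⟩ := hpt (⌊u.2⌋ : ℤ) (by
        have : q.2 ≤ ⌊u.2⌋ := Int.le_floor.2 hu2.1
        exact_mod_cast this) ((Int.floor_le _).trans hu2.2)
      have hfl := Int.floor_le u.2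
      have hfl2 : ((⌊u.2⌋ : ℤ) : ℝ) ≤ p.2 - d := by linarith
      have hq2 : (q.2 : ℝ) ≤ (⌊u.2⌋ : ℤ) := by
        have : q.2 ≤ ⌊u.2⌋ := Int.le_floor.2 hu2.1
        exact_mod_cast this
      obtain ⟨t1, h1⟩ := hpt ((⌊u.2⌋ : ℤ) + d)
        (by linarith [(Nat.cast_nonneg d : (0 : ℝ) ≤ d)]) (by linarith)
      have hd1 : (1 : ℝ) ≤ d := by exact_mod_cast hP.2.2.1.1
      exact aux_count hP.1 hP.2.1 d _ t0 t1 w.1 u.1 u.2 h0 h1 hw' hu' hfl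
        (by linarith [Int.lt_floor_add_one u.2]) hx

lemma aux_doneX {P : Set (ℝ × ℝ)} {d : ℕ} (hP : AuxGood P d) {u w : ℝ × ℝ} (hu : u ∈ P) (hw : w ∈ P)
    (hy : u.1 = w.1) (hx : 3 * d / 4 ≤ u.2 - w.2) : d ^ 2 ≤ 4 * (polygonGenus P + 2) := by
  have hφ : IsZAffine (fun p : ℝ × ℝ => (p.2, p.1)) :=
    ⟨0, 1, 1, 0, 0, 0, by norm_num, fun p => by simp⟩
  rw [← aux_zgenus hφ P]
  exact aux_done (aux_zgood hφ hP) ⟨u, hu, rfl⟩ ⟨w, hw, rfl⟩ hy hx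

lemma aux_doneD {P : Set (ℝ × ℝ)} {d : ℕ} (hP : AuxGood P d) {u w : ℝ × ℝ} (hu : u ∈ P) (hw : w ∈ P)
    (hy : u.1 - u.2 = w.1 - w.2) (hx : 3 * d / 4 ≤ u.2 - w.2) :
    d ^ 2 ≤ 4 * (polygonGenus P + 2) := by
  have hφ : IsZAffine (fun p : ℝ × ℝ => (p.2, p.1 - p.2)) :=
    ⟨0, 1, 1, -1, 0, 0, by norm_num, fun p => by ext <;> simp <;> ring⟩
  rw [← aux_zgenus hφ P]
  exact aux_done (aux_zgood hφ hP) ⟨u, hu, rfl⟩ ⟨w, hw, rfl⟩ hy hx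


lemma aux_comb {P : Set (ℝ × ℝ)} (hc : Convex ℝ P) {p p' : ℝ × ℝ} (hp : p ∈ P) (hp' : p' ∈ P)
    {s t : ℝ} (hs : 0 ≤ s) (ht : 0 ≤ t) (hst : 0 < s + t) :
    ((s * p.1 + t * p'.1) / (s + t), (s * p.2 + t * p'.2) / (s + t)) ∈ P := by
  have := hc hp hp' (a := s / (s + t)) (b := t / (s + t)) (by positivity) (by positivity)
    (by field_simp)
  convert this using 1
  ext <;> simp <;> field_simp

lemma aux_convex {P : Set (ℝ × ℝ)} {d : ℕ} (hP : AuxGood P d) : Convex ℝ P := by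
  obtain ⟨⟨S, -, rfl⟩, -⟩ := hP
  exact convex_convexHull ℝ _

lemma aux_combY {P : Set (ℝ × ℝ)} {d : ℕ} (hP : AuxGood P d) {p q p' q' : ℝ × ℝ}
    (hp : p ∈ P) (hq : q ∈ P) (hp' : p' ∈ P) (hq' : q' ∈ P) {s t : ℝ}
    (hs : 0 ≤ s) (ht : 0 ≤ t) (hst : 0 < s + t)
    (h0 : s * (p.2 - q.2) + t * (p'.2 - q'.2) = 0)
    (h1 : 3 * d / 4 * (s + t) ≤ s * (p.1 - q.1) + t * (p'.1 - q'.1)) :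
    d ^ 2 ≤ 4 * (polygonGenus P + 2) := by
  have hc := aux_convex hP
  refine aux_done hP (aux_comb hc hp hp' hs ht hst) (aux_comb hc hq hq' hs ht hst) ?_ ?_
  · simp only
    congr 1
    linarith
  · simp only
    rw [← sub_div, le_div_iff₀ hst]
    linarith

lemma aux_combX {P : Set (ℝ × ℝ)} {d : ℕ} (hP : AuxGood P d) {p q p' q' : ℝ × ℝ}
    (hp : p ∈ P) (hq : q ∈ P) (hp' : p' ∈ P) (hq' : q' ∈ P) {s t : ℝ}
    (hs : 0 ≤ s) (ht : 0 ≤ t) (hst : 0 < s + t)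
    (h0 : s * (p.1 - q.1) + t * (p'.1 - q'.1) = 0)
    (h1 : 3 * d / 4 * (s + t) ≤ s * (p.2 - q.2) + t * (p'.2 - q'.2)) :
    d ^ 2 ≤ 4 * (polygonGenus P + 2) := by
  have hc := aux_convex hP
  refine aux_doneX hP (aux_comb hc hp hp' hs ht hst) (aux_comb hc hq hq' hs ht hst) ?_ ?_
  · simp only
    congr 1
    linarith
  · simp only
    rw [← sub_div, le_div_iff₀ hst]
    linarith

lemma aux_combD {P : Set (ℝ × ℝ)} {d : ℕ} (hP : AuxGood P d) {p q p' q' : ℝ × ℝ}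
    (hp : p ∈ P) (hq : q ∈ P) (hp' : p' ∈ P) (hq' : q' ∈ P) {s t : ℝ}
    (hs : 0 ≤ s) (ht : 0 ≤ t) (hst : 0 < s + t)
    (h0 : s * ((p.1 - p.2) - (q.1 - q.2)) + t * ((p'.1 - p'.2) - (q'.1 - q'.2)) = 0)
    (h1 : 3 * d / 4 * (s + t) ≤ s * (p.2 - q.2) + t * (p'.2 - q'.2)) :
    d ^ 2 ≤ 4 * (polygonGenus P + 2) := by
  have hc := aux_convex hP
  refine aux_doneD hP (aux_comb hc hp hp' hs ht hst) (aux_comb hc hq hq' hs ht hst) ?_ ?_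
  · simp only
    rw [← sub_div, ← sub_div]
    congr 1
    linarith
  · simp only
    rw [← sub_div, le_div_iff₀ hst]
    linarith

lemma aux_ineq1 {d e z α : ℝ} (hz : 0 ≤ z) (hze : z ≤ e) (he : e ≤ d)
    (hα : d - e ≤ α) (hd : 0 < d) : 3 * d / 4 * (α + z) ≤ α * d + z * e := by
  have h1 : d * (d - e) ≤ d * α := mul_le_mul_of_nonneg_left hα hd.le
  by_cases h : 3 * d / 4 ≤ e
  · nlinarith [mul_nonneg hz (sub_nonneg.2 h), mul_nonneg hd.le (sub_nonneg.2 he)]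
  · push Not at h
    nlinarith [mul_nonneg (sub_nonneg.2 hze) (sub_nonneg.2 h.le), sq_nonneg (e - d / 2)]

lemma aux_ineq2 {d s t a : ℝ} (hs : 0 ≤ s) (hst : s ≤ t) (ha : d ≤ a) (hd : 0 < d) :
    3 * d / 4 * (a + s) ≤ a * d + s * t := by
  have h1 : d * d ≤ d * a := mul_le_mul_of_nonneg_left ha hd.le
  nlinarith [mul_nonneg hs (sub_nonneg.2 hst), sq_nonneg (s - 3 * d / 8)]

lemma aux_ineq3 {d s t a : ℝ} (hs : 0 ≤ s) (hst : s ≤ t) (ha : d ≤ a) (hd : 0 < d) :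
    3 * d / 4 * (s + d) ≤ s * t + d * a := by
  have h1 : d * d ≤ d * a := mul_le_mul_of_nonneg_left ha hd.le
  nlinarith [mul_nonneg hs (sub_nonneg.2 hst), sq_nonneg (s - 3 * d / 8)]

lemma aux_main {P : Set (ℝ × ℝ)} {d : ℕ} (hP : AuxGood P d)
    (hst : ∀ r ∈ P, 0 ≤ r.2 ∧ r.2 ≤ d) {T B : ℝ × ℝ} (hT : T ∈ P) (hB : B ∈ P)
    (hTB : T.2 - B.2 = d) (hz0 : 0 ≤ T.1 - B.1) (hz1 : T.1 - B.1 ≤ d) :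
    d ^ 2 ≤ 4 * (polygonGenus P + 2) := by
  have hd : (0 : ℝ) < d := by exact_mod_cast hP.2.2.1.1
  obtain ⟨p1, p2, hp1, hp2, -, ha⟩ := aux_width hP 0 1 1 0 (by norm_num)
  obtain ⟨p3, p4, hp3, hp4, -, hb⟩ := aux_width hP 0 1 1 (-1) (by norm_num)
  have hy1 := hst _ hp1
  have hy2 := hst _ hp2
  have hy3 := hst _ hp3
  have hy4 := hst _ hp4
  generalize hq1 : latticeEmbed p1 = q1 at *
  generalize hq2 : latticeEmbed p2 = q2 at *
  generalize hq3 : latticeEmbed p3 = q3 at *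
  generalize hq4 : latticeEmbed p4 = q4 at *
  have ha' : (d : ℝ) ≤ q1.1 - q2.1 := by
    rw [← hq1, ← hq2]
    simp only [latticeEmbed]
    push_cast at ha
    linarith
  have hb' : (d : ℝ) ≤ (q3.1 - q3.2) - (q4.1 - q4.2) := by
    rw [← hq3, ← hq4]
    simp only [latticeEmbed]
    push_cast at hb
    linarith
  clear ha hb hq1 hq2 hq3 hq4
  rcases lt_or_ge (q1.2 - q2.2) 0 with he | he
  · -- `e < 0`
    rcases le_total (q2.2 - q1.2) (T.1 - B.1) with h | h
    · refine aux_combY hP hT hB hp1 hp2 (s := q2.2 - q1.2) (t := d) (by linarith) hd.le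
        (by linarith) (by rw [hTB]; ring) ?_
      exact aux_ineq3 (by linarith) h ha' hd
    · refine aux_combX hP hT hB hp2 hp1 (s := q1.1 - q2.1) (t := T.1 - B.1) (by linarith) hz0
        (by linarith) (by ring) ?_
      rw [hTB]
      exact aux_ineq2 hz0 h ha' hd
  rcases lt_or_ge 0 (q3.2 - q4.2) with hf | hf
  · rcases le_total (q3.2 - q4.2) (d - (T.1 - B.1)) with h | h
    · refine aux_combY hP hB hT hp3 hp4 (s := q3.2 - q4.2) (t := d) (by linarith) hd.le
        (by linarith) (by rw [show B.2 - T.2 = -d by linarith]; ring) ?_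
      have := aux_ineq3 hf.le h hb' hd
      nlinarith
    · refine aux_combD hP hT hB hp3 hp4 (s := (q3.1 - q3.2) - (q4.1 - q4.2))
        (t := d - (T.1 - B.1)) (by linarith) (by linarith)
        (by linarith) (by rw [← hTB]; ring) ?_
      rw [hTB]
      exact aux_ineq2 (by linarith) h hb' hd
  -- now `e ≥ 0`, `f ≥ 0`
  rcases le_total ((q1.2 - q2.2) + (q4.2 - q3.2)) d with h1 | h1
  · rcases eq_or_lt_of_le (show 0 ≤ (q1.2 - q2.2) + (q4.2 - q3.2) by linarith) with h0 | h0
    · refine aux_done hP hp1 hp2 (by linarith) (by linarith)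
    · refine aux_combY hP hp1 hp2 hp3 hp4 (s := q4.2 - q3.2) (t := q1.2 - q2.2) (by linarith)
        (by linarith) (by linarith) (by ring) ?_
      set e := q1.2 - q2.2
      have hf' : 0 ≤ q4.2 - q3.2 := by linarith
      have hx3 : d - (q4.2 - q3.2) ≤ q3.1 - q4.1 := by linarith
      set f := q4.2 - q3.2
      have m1 := mul_le_mul_of_nonneg_left ha' hf'
      have m2 := mul_le_mul_of_nonneg_left hx3 he
      nlinarith [sq_nonneg (e - f), mul_nonneg h0.le (sub_nonneg.2 h1)]
  rcases le_total (T.1 - B.1) (q4.2 - q3.2) with h2 | h2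
  · rcases eq_or_lt_of_le (show 0 ≤ (q3.1 - q4.1) + (T.1 - B.1) by linarith) with h0 | h0
    · refine aux_doneX hP hp4 hp3 (by linarith) (by linarith)
    · refine aux_combX hP hT hB hp4 hp3 (s := q3.1 - q4.1) (t := T.1 - B.1) (by linarith) hz0
        (by linarith) (by ring) ?_
      rw [hTB]
      exact aux_ineq1 hz0 h2 (by linarith) (by linarith) hd
  · rcases eq_or_lt_of_le (show 0 ≤ ((q1.1 - q1.2) - (q2.1 - q2.2)) + (d - (T.1 - B.1)) by linarith)
      with h0 | h0
    · refine aux_doneD hP hp1 hp2 (by linarith) (by linarith)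
    · refine aux_combD hP hT hB hp1 hp2 (s := (q1.1 - q1.2) - (q2.1 - q2.2))
        (t := d - (T.1 - B.1)) (by linarith) (by linarith) (by linarith)
        (by rw [← hTB]; ring) ?_
      rw [hTB]
      exact aux_ineq1 (by linarith) (by linarith) (by linarith) (by linarith) hd

lemma aux_final {P : Set (ℝ × ℝ)} {d : ℕ} (hP : AuxGood P d) :
    d ^ 2 ≤ 4 * (polygonGenus P + 2) := by
  have hd : 0 < d := hP.2.2.1.1
  obtain ⟨φ, hφ, hs⟩ := hP.2.2.1.2
  rw [← aux_zgenus hφ P]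
  have hQ := aux_zgood hφ hP
  generalize φ '' P = Q at *
  clear hP
  obtain ⟨p, q, hp, hq, -, hw⟩ := aux_width hQ 1 0 0 1 (by norm_num)
  have hp2 := hs hp
  have hq2 := hs hq
  simp only [strip, latticeEmbed, Set.mem_ofPred_eq] at hp2 hq2
  push_cast at hw
  set k : ℤ := (p.1 - q.1) / (d : ℤ) with hk
  have hdz : (0 : ℤ) < d := by exact_mod_cast hd
  have hk1 : 0 ≤ (p.1 - q.1) - k * d := by
    have := Int.ediv_mul_le (p.1 - q.1) hdz.ne'
    linarith
  have hk2 : (p.1 - q.1) - k * d ≤ d := by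
    have := Int.lt_ediv_add_one_mul_self (p.1 - q.1) hdz
    linarith
  have hk1' : (0 : ℝ) ≤ (p.1 - q.1) - k * d := by exact_mod_cast hk1
  have hk2' : ((p.1 - q.1) - k * d : ℝ) ≤ d := by exact_mod_cast hk2
  have hψ : IsZAffine (fun r : ℝ × ℝ => (r.1 - k * r.2, r.2)) :=
    ⟨1, -k, 0, 1, 0, 0, by norm_num, fun r => by ext <;> simp <;> ring⟩
  rw [← aux_zgenus hψ Q]
  have hdiff : (p.2 : ℝ) - q.2 = d := by linarith
  refine aux_main (aux_zgood hψ hQ) ?_ ⟨_, hp, rfl⟩ ⟨_, hq, rfl⟩ ?_ ?_ ?_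
  · rintro _ ⟨r, hr, rfl⟩
    have h5 := hs hr
    simp only [strip, Set.mem_ofPred_eq] at h5
    exact h5
  · exact hdiff
  · simp only [latticeEmbed]
    rw [← hdiff] at hk1'
    linarith
  · simp only [latticeEmbed]
    have : (k : ℝ) * d = k * p.2 - k * q.2 := by rw [← hdiff]; ring
    linarith

/-- A maximal two-dimensional lattice polygon of genus `g` and lattice width `d`
satisfies `d ≤ 2√(g + 2)`. -/
theorem stmt5 (P : Set (ℝ × ℝ)) (d : ℕ)
    (hP : IsMaximalPolygon P) (h2 : TwoDimensional P)
    (hlw : LatticeWidthIs P d) :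
    (d : ℝ) ≤ 2 * Real.sqrt ((polygonGenus P : ℝ) + 2) := by
  have h := aux_final (P := P) (d := d) ⟨hP.1, h2, hlw⟩
  have h' : (d : ℝ) ^ 2 ≤ 4 * ((polygonGenus P : ℝ) + 2) := by exact_mod_cast h
  have hs := Real.sq_sqrt (show (0 : ℝ) ≤ (polygonGenus P : ℝ) + 2 by positivity)
  have hn := Real.sqrt_nonneg ((polygonGenus P : ℝ) + 2)
  refine abs_le_of_sq_le_sq' ?_ (by positivity) |>.2
  rw [mul_pow, hs]
  linarith
end

section
/- Let d ≥ 3 and g ≥ d³ be integers. Then there exists a maximal lattice polygon P with exactly g interior lattice points, lattice width d, and expected gonality d, such that g + r(P) − 3 − c(P) ≥ U(g, d) − (d + 4), where U(g, d) = g + 2g/(d − 1) + 2d − 3. -/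
open Set

/-- The polygon bounded on the right by a concave integer function. -/
def PPf (f : ℤ → ℤ) (D : ℤ) : Set (ℝ × ℝ) :=
  {p : ℝ × ℝ | 0 ≤ p.2 ∧ p.2 ≤ D ∧ 0 ≤ p.1 ∧
    ∀ j ∈ Finset.Icc (1:ℤ) (D-2), p.1 ≤ f j + ((f (j+1) : ℝ) - f j) * (p.2 - j)}

/-- The hypotheses on the bounding function. -/
structure GoodF (f : ℤ → ℤ) (D : ℤ) : Prop where
  hD : 3 ≤ D
  conc : ∀ j, f (j+1) - f j ≤ f j - f (j-1)
  h1 : f 2 - f 1 = f 1 - f 0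
  h2 : f D - f (D-1) = f (D-1) - f (D-2)
  big : ∀ y, 0 ≤ y → y ≤ D → D + 2 ≤ f y
  hα : f 0 - f 1 = 0 ∨ f 0 - f 1 = 1

lemma GoodF.tan {f : ℤ → ℤ} {D : ℤ} (h : GoodF f D) (j y : ℤ) :
    f y ≤ f j + (f (j+1) - f j) * (y - j) := by
  have key : ∀ n : ℕ, f (j + n + 1) - f (j + n) ≤ f (j+1) - f j ∧
      f (j + n) ≤ f j + (f (j+1) - f j) * n := by
    intro n
    induction n with
    | zero => simp
    | succ n ih =>
      have := h.conc (j + n + 1)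
      rw [show j + n + 1 - 1 = j + n by ring] at this
      push_cast
      rw [show j + ((n:ℤ)+1) = j + n + 1 by ring]
      constructor
      · linarith [ih.1]
      · nlinarith [ih.1, ih.2]
  have key2 : ∀ n : ℕ, f (j+1) - f j ≤ f (j - n + 1) - f (j - n) ∧
      f (j - n) ≤ f j - (f (j+1) - f j) * n := by
    intro n
    induction n with
    | zero => simp
    | succ n ih =>
      have := h.conc (j - n)
      push_cast
      rw [show j - ((n:ℤ)+1) + 1 = j - n by ring, show j - ((n:ℤ)+1) = j - n - 1 by ring]
      constructor
      · linarith [ih.1]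
      · nlinarith [ih.1, ih.2]
  rcases le_total j y with hy | hy
  · have := (key (y - j).toNat).2
    rw [Int.toNat_of_nonneg (by omega)] at this
    rwa [show j + (y - j) = y by ring] at this
  · have := (key2 (j - y).toNat).2
    rw [Int.toNat_of_nonneg (by omega)] at this
    rw [show j - (j - y) = y by ring] at this
    linarith

lemma mem_PPf_lattice {f : ℤ → ℤ} {D : ℤ} (h : GoodF f D) (p : ℤ × ℤ) :
    latticeEmbed p ∈ PPf f D ↔ 0 ≤ p.2 ∧ p.2 ≤ D ∧ 0 ≤ p.1 ∧ p.1 ≤ f p.2 := by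
  obtain ⟨a, b⟩ := p
  have hD := h.hD
  simp only [PPf, latticeEmbed, mem_ofPred_eq]
  have e : ∀ j : ℤ, ((a:ℝ) ≤ f j + ((f (j+1) : ℝ) - f j) * (b - j)) ↔
      a ≤ f j + (f (j+1) - f j) * (b - j) := fun j => by exact_mod_cast Iff.rfl
  simp only [e]
  norm_cast
  constructor
  · rintro ⟨h1, h2, h3, h4⟩
    refine ⟨h1, h2, h3, ?_⟩
    rcases eq_or_lt_of_le h1 with rfl | hb
    · have := h4 1 (by simp; omega)
      have := h.h1
      norm_num at *
      linarith
    rcases eq_or_lt_of_le h2 with rfl | hb'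
    · have := h4 (b-2) (by simp; omega)
      have := h.h2
      rw [show b - 2 + 1 = b - 1 by ring] at *
      linarith
    by_cases hb2 : b = D - 1
    · subst hb2
      have := h4 (D-2) (by simp; omega)
      rw [show D - 2 + 1 = D - 1 by ring] at *
      linarith
    · have := h4 b (by simp; omega)
      simpa using this
  · rintro ⟨h1, h2, h3, h4⟩
    exact ⟨h1, h2, h3, fun j _ => h4.trans (h.tan j b)⟩

lemma convex_PPf (f : ℤ → ℤ) (D : ℤ) : Convex ℝ (PPf f D) := by
  intro p hp q hq s t hs ht hst
  obtain ⟨p1, p2, p3, p4⟩ := hp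
  obtain ⟨q1, q2, q3, q4⟩ := hq
  have hs' : s = 1 - t := by linarith
  have h1t : 0 ≤ 1 - t := by linarith
  subst hs'
  refine ⟨?_, ?_, ?_, ?_⟩
  · simp; positivity
  · simp; nlinarith
  · simp; positivity
  · intro j hj
    have a := p4 j hj
    have b := q4 j hj
    simp
    nlinarith

lemma isClosed_PPf (f : ℤ → ℤ) (D : ℤ) : IsClosed (PPf f D) := by
  have : PPf f D = {p : ℝ × ℝ | 0 ≤ p.2} ∩ ({p : ℝ × ℝ | p.2 ≤ (D:ℝ)} ∩ ({p : ℝ × ℝ | 0 ≤ p.1} ∩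
    ⋂ j ∈ Finset.Icc (1:ℤ) (D-2), {p | p.1 ≤ f j + ((f (j+1) : ℝ) - f j) * (p.2 - j)})) := by
    ext p; simp [PPf]
  rw [this]
  refine IsClosed.inter (isClosed_le (by fun_prop) (by fun_prop)) ?_
  refine IsClosed.inter (isClosed_le (by fun_prop) (by fun_prop)) ?_
  refine IsClosed.inter (isClosed_le (by fun_prop) (by fun_prop)) ?_
  exact isClosed_biInter fun j _ => isClosed_le (by fun_prop) (by fun_prop)

/-- Strict version. -/
def PPs (f : ℤ → ℤ) (D : ℤ) : Set (ℝ × ℝ) :=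
  {p : ℝ × ℝ | 0 < p.2 ∧ p.2 < D ∧ 0 < p.1 ∧
    ∀ j ∈ Finset.Icc (1:ℤ) (D-2), p.1 < f j + ((f (j+1) : ℝ) - f j) * (p.2 - j)}

lemma isOpen_PPs (f : ℤ → ℤ) (D : ℤ) : IsOpen (PPs f D) := by
  have : PPs f D = {p : ℝ × ℝ | 0 < p.2} ∩ ({p : ℝ × ℝ | p.2 < (D:ℝ)} ∩ ({p : ℝ × ℝ | 0 < p.1} ∩
    ⋂ j ∈ Finset.Icc (1:ℤ) (D-2), {p | p.1 < f j + ((f (j+1) : ℝ) - f j) * (p.2 - j)})) := by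
    ext p; simp [PPs]
  rw [this]
  refine IsOpen.inter (isOpen_lt (by fun_prop) (by fun_prop)) ?_
  refine IsOpen.inter (isOpen_lt (by fun_prop) (by fun_prop)) ?_
  refine IsOpen.inter (isOpen_lt (by fun_prop) (by fun_prop)) ?_
  exact isOpen_biInter_finset fun j _ => isOpen_lt (by fun_prop) (by fun_prop)

lemma interior_PPf (f : ℤ → ℤ) (D : ℤ) : interior (PPf f D) = PPs f D := by
  apply subset_antisymm
  · intro p hp
    rw [mem_interior_iff_mem_nhds, Metric.mem_nhds_iff] at hp
    obtain ⟨ε, hε, hb⟩ := hp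
    have q1 : (p.1 + ε/2, p.2) ∈ PPf f D := hb (by
      simp [Prod.dist_eq, abs_of_pos hε, hε])
    have q2 : (p.1 - ε/2, p.2) ∈ PPf f D := hb (by
      simp [Prod.dist_eq, abs_of_pos hε, hε])
    have q3 : (p.1, p.2 + ε/2) ∈ PPf f D := hb (by
      simp [Prod.dist_eq, abs_of_pos hε, hε])
    have q4 : (p.1, p.2 - ε/2) ∈ PPf f D := hb (by
      simp [Prod.dist_eq, abs_of_pos hε, hε])
    refine ⟨?_, ?_, ?_, ?_⟩
    · have := q4.1; simp at this; linarith
    · have := q3.2.1; simp at this; linarith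
    · have := q2.2.2.1; simp at this; linarith
    · intro j hj
      have := q1.2.2.2 j hj; simp only at this; linarith
  · apply interior_maximal _ (isOpen_PPs f D)
    rintro p ⟨h1, h2, h3, h4⟩
    exact ⟨h1.le, h2.le, h3.le, fun j hj => (h4 j hj).le⟩

lemma mem_int_lattice {f : ℤ → ℤ} {D : ℤ} (h : GoodF f D) (p : ℤ × ℤ) :
    latticeEmbed p ∈ interior (PPf f D) ↔ 0 < p.2 ∧ p.2 < D ∧ 0 < p.1 ∧ p.1 < f p.2 := by
  rw [interior_PPf]
  obtain ⟨a, b⟩ := p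
  have hD := h.hD
  simp only [PPs, latticeEmbed, mem_ofPred_eq]
  have e : ∀ j : ℤ, ((a:ℝ) < f j + ((f (j+1) : ℝ) - f j) * (b - j)) ↔
      a < f j + (f (j+1) - f j) * (b - j) := fun j => by exact_mod_cast Iff.rfl
  simp only [e]
  norm_cast
  constructor
  · rintro ⟨h1, h2, h3, h4⟩
    refine ⟨h1, h2, h3, ?_⟩
    by_cases hb2 : b = D - 1
    · subst hb2
      have := h4 (D-2) (by simp; omega)
      rw [show D - 2 + 1 = D - 1 by ring] at *
      linarith
    · have := h4 b (by simp; omega)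
      simpa using this
  · rintro ⟨h1, h2, h3, h4⟩
    exact ⟨h1, h2, h3, fun j _ => h4.trans_le (h.tan j b)⟩

lemma isLattice_PPf {f : ℤ → ℤ} {D : ℤ} (h : GoodF f D) : IsLatticePolygon (PPf f D) := by
  have hD := h.hD
  refine ⟨(Finset.Icc 0 D).image (fun y => ((0:ℤ), y)) ∪ (Finset.Icc 0 D).image (fun y => (f y, y)),
    ⟨(0, 0), by simp; omega⟩, ?_⟩
  apply subset_antisymm
  · rintro ⟨x, y⟩ ⟨h1, h2, h3, h4⟩
    simp only at h1 h2 h3 h4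
    obtain ⟨j, hj0, hjD, hjy, hyj⟩ : ∃ j : ℤ, 0 ≤ j ∧ j ≤ D - 1 ∧ (j:ℝ) ≤ y ∧ y ≤ j + 1 := by
      by_cases hy : y = D
      · refine ⟨D - 1, by omega, le_refl _, ?_, ?_⟩ <;> push_cast <;> linarith
      · refine ⟨⌊y⌋, Int.floor_nonneg.2 h1, ?_, Int.floor_le y, (Int.lt_floor_add_one y).le⟩
        have : ⌊y⌋ < D := Int.floor_lt.2 (lt_of_le_of_ne h2 hy)
        omega
    have hx : x ≤ f j + ((f (j+1) : ℝ) - f j) * (y - j) := by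
      by_cases c0 : j = 0
      · subst c0
        have a := h4 1 (by simp; omega)
        have b : (f 2 : ℝ) - f 1 = f 1 - f 0 := by exact_mod_cast h.h1
        norm_num at *
        rw [b] at a
        linarith
      by_cases c1 : j = D - 1
      · subst c1
        have a := h4 (D-2) (by simp; omega)
        have b : (f D : ℝ) - f (D-1) = f (D-1) - f (D-2) := by exact_mod_cast h.h2
        rw [show D - 2 + 1 = D - 1 by ring] at a
        rw [show D - 1 + 1 = D by ring]
        push_cast at *
        rw [b]
        linarith
      · exact h4 j (by simp; omega)
    set t := y - j with ht
    have hF0 : (0:ℝ) < f j := by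
      have := h.big j hj0 (by omega)
      exact_mod_cast (by omega : 0 < f j)
    have hF1 : (0:ℝ) < f (j+1) := by
      have := h.big (j+1) (by omega) (by omega)
      exact_mod_cast (by omega : 0 < f (j+1))
    have ht0 : 0 ≤ t := by linarith
    have ht1 : 0 ≤ 1 - t := by linarith
    set F := (f j:ℝ) + ((f (j+1) : ℝ) - f j) * t with hF
    have hFp : 0 < F := by
      have : F = (1 - t) * f j + t * f (j+1) := by rw [hF]; ring
      rw [this]
      rcases eq_or_lt_of_le ht0 with h0 | h0
      · rw [← h0]; simpa using hF0
      · positivity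
    set C := convexHull ℝ (latticeEmbed '' (((Finset.Icc 0 D).image (fun y => ((0:ℤ), y)) ∪
      (Finset.Icc 0 D).image (fun y => (f y, y)) : Finset (ℤ × ℤ)) : Set (ℤ × ℤ))) with hC
    have hconv : Convex ℝ C := convex_convexHull _ _
    have m0 : ∀ k : ℤ, 0 ≤ k → k ≤ D → ((0:ℝ), (k:ℝ)) ∈ C := fun k a b =>
      subset_convexHull _ _ ⟨(0, k), by simp; omega, by simp [latticeEmbed]⟩
    have m1 : ∀ k : ℤ, 0 ≤ k → k ≤ D → ((f k:ℝ), (k:ℝ)) ∈ C := fun k a b =>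
      subset_convexHull _ _ ⟨(f k, k), by simp; omega, by simp [latticeEmbed]⟩
    have A := hconv (m0 j hj0 (by omega)) (m0 (j+1) (by omega) (by omega)) ht1 ht0 (by ring)
    have B := hconv (m1 j hj0 (by omega)) (m1 (j+1) (by omega) (by omega)) ht1 ht0 (by ring)
    have hu1 : 0 ≤ 1 - x / F := by
      have : x / F ≤ 1 := (div_le_one hFp).2 hx
      linarith
    have := hconv A B hu1 (div_nonneg h3 hFp.le) (by ring)
    convert this using 1
    ext
    · simp
      field_simp
      rw [hF]; ring
    · simp
      rw [ht]; ring
  · refine convexHull_min ?_ (convex_PPf f D)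
    rintro _ ⟨p, hp, rfl⟩
    rw [mem_PPf_lattice h]
    simp at hp
    rcases hp with ⟨a, ha, rfl⟩ | ⟨a, ha, rfl⟩
    · have := h.big a ha.1 ha.2
      simp; omega
    · have := h.big a ha.1 ha.2
      simp; omega

/-- Triangle lemma. -/
lemma tri_lemma {Q : Set (ℝ × ℝ)} (hQ : Convex ℝ Q) (p e w q : ℤ × ℤ) (α n : ℤ) (hn : 2 ≤ n)
    (hp : latticeEmbed p ∈ interior Q) (hpe : latticeEmbed (p + e) ∈ interior Q)
    (hq : latticeEmbed q ∈ Q) (hqe : q = p + α • e + n • w) :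
    ∃ β : ℤ, latticeEmbed (p + β • e + w) ∈ interior Q := by
  obtain ⟨β, hβ1, hβ2⟩ : ∃ β : ℤ, 0 ≤ n * β - α ∧ n * β - α ≤ n - 1 := by
    refine ⟨-((-α) / n), ?_, ?_⟩
    · have := Int.mul_ediv_self_le (x := -α) (k := n) (by omega)
      linarith
    · have := Int.lt_mul_ediv_self_add (x := -α) (k := n) (by omega)
      linarith
  refine ⟨β, ?_⟩
  have hn' : (2:ℝ) ≤ n := by exact_mod_cast hn
  have hb1 : (0:ℝ) ≤ n * β - α := by exact_mod_cast hβ1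
  have hb2 : (n:ℝ) * β - α ≤ n - 1 := by exact_mod_cast hβ2
  set x : ℝ := (n * β - α) / (n - 1) with hx
  have hx0 : 0 ≤ x := div_nonneg hb1 (by linarith)
  have hx1 : 0 ≤ 1 - x := by
    have : x ≤ 1 := (div_le_one (by linarith)).2 hb2
    linarith
  have h1 := hQ.interior hp hpe hx1 hx0 (by ring)
  have h2 := hQ.combo_interior_self_mem_interior h1 hq
    (a := 1 - 1 / n) (b := 1 / n) (by
      have : (1:ℝ) / n < 1 := (div_lt_one (by linarith)).2 (by linarith)
      linarith) (by positivity) (by ring)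
  convert h2 using 1
  have hn1 : (n:ℝ) - 1 ≠ 0 := by linarith
  have hn0 : (n:ℝ) ≠ 0 := by linarith
  subst hqe
  have hxe : x * (n - 1) = n * β - α := by rw [hx]; field_simp
  clear_value x
  ext
  · simp [latticeEmbed]
    field_simp
    linear_combination (-(e.1:ℝ)) * hxe
  · simp [latticeEmbed]
    field_simp
    linear_combination (-(e.2:ℝ)) * hxe

lemma maximal_PPf {f : ℤ → ℤ} {D : ℤ} (h : GoodF f D) : IsMaximalPolygon (PPf f D) := by
  have hD := h.hD
  refine ⟨isLattice_PPf h, ?_⟩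
  rintro Q ⟨S, hS, rfl⟩ hPQ hint
  set Q := convexHull ℝ (latticeEmbed '' (S : Set (ℤ × ℤ))) with hQd
  have hQ : Convex ℝ Q := convex_convexHull _ _
  have hin : ∀ p : ℤ × ℤ, latticeEmbed p ∈ interior Q ↔
      0 < p.2 ∧ p.2 < D ∧ 0 < p.1 ∧ p.1 < f p.2 := by
    intro p
    rw [← mem_int_lattice h]
    exact Set.ext_iff.1 hint p
  refine subset_antisymm ?_ hPQ
  refine convexHull_min ?_ (convex_PPf f D)
  rintro _ ⟨q, hq, rfl⟩
  have hqQ : latticeEmbed q ∈ Q := subset_convexHull _ _ ⟨q, hq, rfl⟩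
  obtain ⟨a, b⟩ := q
  have b1 := h.big 1 (by omega) (by omega)
  have b2 := h.big 2 (by omega) (by omega)
  have b3 := h.big (D-1) (by omega) (by omega)
  refine ⟨?_, ?_, ?_, ?_⟩
  · by_contra hc
    have hb : b < 0 := by simpa [latticeEmbed] using hc
    obtain ⟨β, hβ⟩ := tri_lemma hQ (1,1) (1,0) (0,-1) (a,b) (a-1) (1-b) (by omega)
      ((hin _).2 (by simp; omega)) ((hin _).2 (by simp; omega)) hqQ (by ext <;> simp)
    have := ((hin _).1 hβ).1
    simp at this
  · by_contra hc
    have hb : D < b := by simpa [latticeEmbed] using hc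
    obtain ⟨β, hβ⟩ := tri_lemma hQ (1,D-1) (1,0) (0,1) (a,b) (a-1) (b-(D-1)) (by omega)
      ((hin _).2 (by simp; omega)) ((hin _).2 (by simp; omega)) hqQ (by ext <;> simp)
    have := ((hin _).1 hβ).2.1
    simp at this
  · by_contra hc
    have hb : a < 0 := by simpa [latticeEmbed] using hc
    obtain ⟨β, hβ⟩ := tri_lemma hQ (1,1) (0,1) (-1,0) (a,b) (b-1) (1-a) (by omega)
      ((hin _).2 (by simp; omega)) ((hin _).2 (by simp; omega)) hqQ (by ext <;> simp)
    have := ((hin _).1 hβ).2.2.1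
    simp at this
  · intro j hj
    rw [Finset.mem_Icc] at hj
    have c1 := h.big j (by omega) (by omega)
    have c2 := h.big (j+1) (by omega) (by omega)
    by_contra hc
    have hb : f j + (f (j+1) - f j) * (b - j) < a := by
      have : (f j:ℝ) + (f (j+1) - f j) * (b - j) < a := by simpa [latticeEmbed] using hc
      exact_mod_cast this
    obtain ⟨β, hβ⟩ := tri_lemma hQ (f j - 1, j) (f (j+1) - f j, 1) (1,0) (a,b) (b-j)
      (a - (f j - 1) - (b - j) * (f (j+1) - f j)) (by linarith)
      ((hin _).2 (by simp; omega)) ((hin _).2 (by simp; omega)) hqQ (by ext <;> simp)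
    have := ((hin _).1 hβ).2.2.2
    simp at this
    have := h.tan j (j + β)
    linarith

lemma width_lemma (P : Set (ℝ × ℝ)) (x0 y0 L : ℤ) (w : ℕ) (hw : 0 < w) (hL : (w:ℤ) ≤ L)
    (m0 : latticeEmbed (x0, y0) ∈ P) (m1 : latticeEmbed (x0, y0 + w) ∈ P)
    (m2 : latticeEmbed (x0 + L, y0) ∈ P)
    (hP : ∀ p ∈ P, (y0:ℝ) ≤ p.2 ∧ p.2 ≤ y0 + w) : LatticeWidthIs P w := by
  constructor
  · refine ⟨hw, fun p => (p.1, p.2 - y0), ⟨1, 0, 0, 1, 0, -y0, by simp, ?_⟩, ?_⟩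
    · intro p; ext <;> simp; ring
    · rintro _ ⟨p, hp, rfl⟩
      have := hP p hp
      constructor <;> simp <;> linarith
  · rintro s ⟨hs, φ, ⟨a, b, c, d, e, k, hdet, hφ⟩, hsub⟩
    have s0 := hsub ⟨_, m0, rfl⟩
    have s1 := hsub ⟨_, m1, rfl⟩
    have s2 := hsub ⟨_, m2, rfl⟩
    rw [hφ] at s0 s1 s2
    simp only [strip, latticeEmbed, mem_ofPred_eq] at s0 s1 s2
    norm_cast at s0 s1 s2
    by_cases hc : c = 0
    · subst hc
      have hd : d = 1 ∨ d = -1 := by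
        have : IsUnit d := by
          rw [mul_zero, sub_zero] at hdet
          rcases hdet with h | h
          · exact IsUnit.of_mul_eq_one a (by linarith)
          · exact IsUnit.of_mul_eq_one (-a) (by linarith)
        exact Int.isUnit_iff.1 this
      zify
      rcases hd with rfl | rfl <;> push_cast at * <;> omega
    · zify
      push_cast at *
      have h1 : c * L ≤ s := by linarith
      have h2 : -(c * L) ≤ s := by linarith
      rcases lt_or_gt_of_ne hc with h | h <;> nlinarith

lemma not_equiv (P : Set (ℝ × ℝ)) (N : ℤ) (hN : 5 ≤ N) (m0 : latticeEmbed (0, 0) ∈ P)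
    (m1 : latticeEmbed (N, 0) ∈ P) : ¬ EquivPolygon P twoUpsilon := by
  rintro ⟨φ, ⟨a, b, c, d, e, k, hdet, hφ⟩, himg⟩
  have hbox : ∀ p ∈ twoUpsilon, (-2 ≤ p.1 ∧ p.1 ≤ 2) ∧ (-2 ≤ p.2 ∧ p.2 ≤ 2) := by
    have hc : Convex ℝ ((Icc (-2:ℝ) 2) ×ˢ (Icc (-2:ℝ) 2)) :=
      (convex_Icc _ _).prod (convex_Icc _ _)
    intro p hp
    have := convexHull_min (t := (Icc (-2:ℝ) 2) ×ˢ (Icc (-2:ℝ) 2)) (by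
      rintro p (rfl | rfl | rfl) <;> norm_num) hc hp
    exact ⟨this.1, this.2⟩
  have s0 := hbox _ (himg ▸ ⟨_, m0, rfl⟩ : φ (latticeEmbed (0,0)) ∈ twoUpsilon)
  have s1 := hbox _ (himg ▸ ⟨_, m1, rfl⟩ : φ (latticeEmbed (N,0)) ∈ twoUpsilon)
  rw [hφ] at s0 s1
  simp only [latticeEmbed] at s0 s1
  obtain ⟨⟨u1, u2⟩, u3, u4⟩ := s0
  obtain ⟨⟨v1, v2⟩, v3, v4⟩ := s1
  have w1 : a * N ≤ 4 := by
    have : (a:ℝ) * N ≤ 4 := by push_cast at *; linarith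
    exact_mod_cast this
  have w2 : -(a * N) ≤ 4 := by
    have : -((a:ℝ) * N) ≤ 4 := by push_cast at *; linarith
    exact_mod_cast this
  have w3 : c * N ≤ 4 := by
    have : (c:ℝ) * N ≤ 4 := by push_cast at *; linarith
    exact_mod_cast this
  have w4 : -(c * N) ≤ 4 := by
    have : -((c:ℝ) * N) ≤ 4 := by push_cast at *; linarith
    exact_mod_cast this
  have ha : a = 0 := by
    by_contra h
    rcases lt_or_gt_of_ne h with h | h <;> nlinarith
  have hc : c = 0 := by
    by_contra h
    rcases lt_or_gt_of_ne h with h | h <;> nlinarith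
  subst ha hc
  simp at hdet

lemma width_PPf {f : ℤ → ℤ} {d : ℕ} (h : GoodF f d) : LatticeWidthIs (PPf f d) d := by
  have hD := h.hD
  have := h.big 0 (by omega) (by omega)
  have := h.big d (by omega) (by omega)
  refine width_lemma _ 0 0 (f 0) d (by omega) (by omega) ?_ ?_ ?_ ?_
  · rw [mem_PPf_lattice h]; simp; omega
  · rw [mem_PPf_lattice h]; simp; omega
  · rw [mem_PPf_lattice h]; simp; omega
  · rintro p ⟨h1, h2, -⟩
    simp at *
    exact ⟨h1, h2⟩

lemma gon_PPf {f : ℤ → ℤ} {d : ℕ} (h : GoodF f d) : ExpectedGonalityIs (PPf f d) d := by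
  have hD := h.hD
  have c0 := h.big 0 (by omega) (by omega)
  have c1 := h.big 1 (by omega) (by omega)
  have c2 := h.big (d-1) (by omega) (by omega)
  right
  refine ⟨not_equiv _ (f 0) (by omega) ?_ ?_, d - 2, ?_, by omega⟩
  · rw [mem_PPf_lattice h]; simp; omega
  · rw [mem_PPf_lattice h]; simp; omega
  have hd2 : ((d - 2 : ℕ) : ℤ) = d - 2 := by omega
  refine width_lemma _ 1 1 (f 1 - 2) (d-2) (by omega) (by omega) ?_ ?_ ?_ ?_
  · refine subset_convexHull _ _ ⟨_, ?_, rfl⟩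
    refine (mem_int_lattice h _).2 ?_
    simp; omega
  · refine subset_convexHull _ _ ⟨_, ?_, rfl⟩
    refine (mem_int_lattice h _).2 ?_
    simp only [hd2]
    rw [show (1:ℤ) + (d - 2) = d - 1 by ring]
    simp; omega
  · refine subset_convexHull _ _ ⟨_, ?_, rfl⟩
    refine (mem_int_lattice h _).2 ?_
    simp; omega
  · have hc : Convex ℝ ((Set.univ : Set ℝ) ×ˢ (Icc (1:ℝ) (d-1))) :=
      convex_univ.prod (convex_Icc _ _)
    intro p hp
    have := convexHull_min (t := (Set.univ : Set ℝ) ×ˢ (Icc (1:ℝ) (d-1))) (by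
      rintro _ ⟨p, hp, rfl⟩
      have := (mem_int_lattice h _).1 hp
      have e1 : 1 ≤ p.2 := by omega
      have e2 : p.2 ≤ d - 1 := by omega
      simp [latticeEmbed]
      exact ⟨by exact_mod_cast e1, by exact_mod_cast e2⟩) hc hp
    simp at this
    have hd3 : ((d - 2 : ℕ) : ℝ) = d - 2 := by exact_mod_cast hd2
    rw [hd3]
    push_cast
    exact ⟨this.1, by linarith [this.2]⟩

lemma ncard_rows (lo hi : ℤ) (l u : ℤ → ℤ) (hlu : ∀ y, lo ≤ y → y ≤ hi → l y ≤ u y + 1) :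
    {p : ℤ × ℤ | lo ≤ p.2 ∧ p.2 ≤ hi ∧ l p.2 ≤ p.1 ∧ p.1 ≤ u p.2}.Finite ∧
    (({p : ℤ × ℤ | lo ≤ p.2 ∧ p.2 ≤ hi ∧ l p.2 ≤ p.1 ∧ p.1 ≤ u p.2}.ncard : ℕ) : ℤ)
      = ∑ y ∈ Finset.Icc lo hi, (u y + 1 - l y) := by
  have e : {p : ℤ × ℤ | lo ≤ p.2 ∧ p.2 ≤ hi ∧ l p.2 ≤ p.1 ∧ p.1 ≤ u p.2} =
      (fun z : (Σ _ : ℤ, ℤ) => (z.2, z.1)) ''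
        (((Finset.Icc lo hi).sigma (fun y => Finset.Icc (l y) (u y)) : Finset (Σ _ : ℤ, ℤ)) :
          Set (Σ _ : ℤ, ℤ)) := by
    ext ⟨a, b⟩
    simp
    tauto
  rw [e]
  constructor
  · exact (Finset.finite_toSet _).image _
  · rw [Set.ncard_image_of_injective, Set.ncard_coe_finset, Finset.card_sigma]
    · push_cast
      refine Finset.sum_congr rfl fun y hy => ?_
      rw [Finset.mem_Icc] at hy
      have := hlu y hy.1 hy.2
      rw [Int.card_Icc]
      omega
    · rintro ⟨a, b⟩ ⟨c, d⟩ h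
      simp at h
      simp [h]

lemma intPts_eq {f : ℤ → ℤ} {D : ℤ} (h : GoodF f D) :
    interiorLatticePoints (PPf f D) =
      {p : ℤ × ℤ | 1 ≤ p.2 ∧ p.2 ≤ D - 1 ∧ 1 ≤ p.1 ∧ p.1 ≤ f p.2 - 1} := by
  ext p
  rw [interiorLatticePoints, mem_ofPred_eq, mem_int_lattice h, mem_ofPred_eq]
  omega

lemma genus_PPf {f : ℤ → ℤ} {D : ℤ} (h : GoodF f D) :
    (polygonGenus (PPf f D) : ℤ) = ∑ y ∈ Finset.Icc 1 (D-1), (f y - 1) := by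
  rw [polygonGenus, intPts_eq h,
    (ncard_rows 1 (D-1) (fun _ => 1) (fun y => f y - 1) ?_).2]
  · refine Finset.sum_congr rfl fun y _ => by ring
  · intro y a b
    have := h.big y (by omega) (by omega)
    have := h.hD
    omega

lemma bdry_PPf {f : ℤ → ℤ} {D : ℤ} (h : GoodF f D) :
    (boundaryLatticeCount (PPf f D) : ℤ) = f 0 + f D + 2 * D := by
  have hD := h.hD
  have e : {p : ℤ × ℤ | latticeEmbed p ∈ frontier (PPf f D)} =
      {p : ℤ × ℤ | 0 ≤ p.2 ∧ p.2 ≤ D ∧ 0 ≤ p.1 ∧ p.1 ≤ f p.2} \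
      interiorLatticePoints (PPf f D) := by
    ext p
    rw [mem_ofPred_eq, (isClosed_PPf f D).frontier_eq, mem_sdiff, mem_sdiff, mem_PPf_lattice h]
    rfl
  have A := ncard_rows 0 D (fun _ => 0) (fun y => f y) (by
    intro y a b
    have := h.big y (by omega) (by omega)
    omega)
  have B := ncard_rows 1 (D-1) (fun _ => 1) (fun y => f y - 1) (by
    intro y a b
    have := h.big y (by omega) (by omega)
    omega)
  rw [← intPts_eq h] at B
  have hsub : interiorLatticePoints (PPf f D) ⊆
      {p : ℤ × ℤ | 0 ≤ p.2 ∧ p.2 ≤ D ∧ 0 ≤ p.1 ∧ p.1 ≤ f p.2} := by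
    rw [intPts_eq h]
    rintro p ⟨a, b, c, d⟩
    refine ⟨by omega, by omega, by omega, by omega⟩
  have C := Set.ncard_sdiff_add_ncard_of_subset hsub A.1
  rw [boundaryLatticeCount, e]
  have A2 := A.2
  have B2 := B.2
  have sp : Finset.Icc 0 D = insert 0 (insert D (Finset.Icc 1 (D-1))) := by
    ext y; simp; omega
  rw [sp, Finset.sum_insert (by simp; omega), Finset.sum_insert (by simp)] at A2
  have E : ∑ y ∈ Finset.Icc 1 (D-1), (f y + 1 - 0) =
      ∑ y ∈ Finset.Icc 1 (D-1), (f y - 1 + 1 - 1) + 2 * (D - 1) := by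
    have : (2 * (D-1) : ℤ) = ∑ y ∈ Finset.Icc 1 (D-1), 2 := by
      rw [Finset.sum_const, Int.card_Icc]; simp; omega
    rw [this, ← Finset.sum_add_distrib]
    refine Finset.sum_congr rfl fun y _ => by ring
  rw [E] at A2
  zify at C
  linarith

lemma edge_data {P τ : Set (ℝ × ℝ)} (hτ : IsEdge P τ) (m0 : ((0:ℝ), (0:ℝ)) ∈ P)
    (m1 : ((1:ℝ), (0:ℝ)) ∈ P) (m2 : ((0:ℝ), (1:ℝ)) ∈ P) :
    ∃ α β : ℝ, (α ≠ 0 ∨ β ≠ 0) ∧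
      ∀ p, p ∈ τ ↔ p ∈ P ∧ ∀ q ∈ P, α * q.1 + β * q.2 ≤ α * p.1 + β * p.2 := by
  obtain ⟨hexp, hfr⟩ := hτ
  have hne : τ.Nonempty := by
    by_contra h
    rw [Set.not_nonempty_iff_eq_empty] at h
    rw [h, vectorSpan_empty, finrank_bot] at hfr
    exact absurd hfr (by norm_num)
  obtain ⟨l, hl⟩ := hexp hne
  have hlin : ∀ p : ℝ × ℝ, l p = l (1,0) * p.1 + l (0,1) * p.2 := by
    intro p
    have : p = p.1 • ((1:ℝ),(0:ℝ)) + p.2 • ((0:ℝ),(1:ℝ)) := by ext <;> simp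
    conv_lhs => rw [this]
    rw [map_add, map_smul, map_smul]
    simp; ring
  refine ⟨l (1,0), l (0,1), ?_, ?_⟩
  · by_contra hc
    push Not at hc
    have hP : τ = P := by
      rw [hl]
      ext p
      simp only [mem_ofPred_eq]
      constructor
      · exact fun h => h.1
      · intro h
        refine ⟨h, fun y _ => ?_⟩
        rw [hlin, hlin p, hc.1, hc.2]; simp
    rw [hP] at hfr
    have htop : vectorSpan ℝ P = ⊤ := by
      rw [eq_top_iff]
      rintro ⟨x, y⟩ -
      have e1 := vsub_mem_vectorSpan ℝ m1 m0
      have e2 := vsub_mem_vectorSpan ℝ m2 m0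
      have := Submodule.add_mem _ (Submodule.smul_mem _ x e1) (Submodule.smul_mem _ y e2)
      simpa using this
    rw [htop] at hfr
    simp at hfr
  · intro p
    rw [hl]
    simp only [mem_ofPred_eq]
    constructor
    · rintro ⟨a, b⟩
      exact ⟨a, fun q hq => by rw [← hlin, ← hlin]; exact b q hq⟩
    · rintro ⟨a, b⟩
      exact ⟨a, fun q hq => by rw [hlin, hlin p]; exact b q hq⟩

lemma col_cases {f : ℤ → ℤ} {D : ℤ} (h : GoodF f D) (a b : ℤ)
    (hv : IsColumnVector (PPf f D) (a, b)) :
    (b = 0 ∧ (a = 1 ∨ a = -1)) ∨ (b = -1 ∧ 0 ≤ a ∧ a ≤ f 0 - f 1) ∨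
      (b = 1 ∧ 0 ≤ a ∧ a ≤ f 1 - f 0) := by
  have hD := h.hD
  have c0 := h.big 0 (by omega) (by omega)
  have c1 := h.big 1 (by omega) (by omega)
  have c2 := h.big D (by omega) (by omega)
  have c3 := h.big (D-1) (by omega) (by omega)
  obtain ⟨hv0, τ, hτ, hsh⟩ := hv
  have hm := mem_PPf_lattice h
  have mm : ∀ x y : ℤ, 0 ≤ y → y ≤ D → 0 ≤ x → x ≤ f y → ((x:ℝ),(y:ℝ)) ∈ PPf f D :=
    fun x y p q r s => (hm (x,y)).2 ⟨p, q, r, s⟩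
  obtain ⟨α, β, hne, hchar⟩ := edge_data hτ
    (by exact_mod_cast mm 0 0 (by omega) (by omega) (by omega) (by omega))
    (by exact_mod_cast mm 1 0 (by omega) (by omega) (by omega) (by omega))
    (by exact_mod_cast mm 0 1 (by omega) (by omega) (by omega) (by omega))
  -- the shift statement
  have sh : ∀ x y : ℤ, 0 ≤ y → y ≤ D → 0 ≤ x → x ≤ f y →
      ((∀ x' y' : ℤ, 0 ≤ y' → y' ≤ D → 0 ≤ x' → x' ≤ f y' →
        α * x' + β * y' ≤ α * x + β * y) ∨
      (0 ≤ y + b ∧ y + b ≤ D ∧ 0 ≤ x + a ∧ x + a ≤ f (y + b))) := by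
    intro x y p q r s
    by_cases ht : latticeEmbed (x,y) ∈ τ
    · left
      intro x' y' p' q' r' s'
      exact ((hchar _).1 ht).2 _ (mm x' y' p' q' r' s')
    · right
      exact (hm _).1 (hsh (x,y) ⟨mm x y p q r s, ht⟩)
  have hD' : (3:ℝ) ≤ D := by exact_mod_cast hD
  have hDp : (0:ℝ) < D := by linarith
  rcases lt_trichotomy b 0 with hb | rfl | hb
  · right; left
    have t0 := (sh 0 0 (by omega) (by omega) (by omega) (by omega)).resolve_right (by omega)
    have t1 := (sh 1 0 (by omega) (by omega) (by omega) (by omega)).resolve_right (by omega)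
    have u0 := t0 1 0 (by omega) (by omega) (by omega) (by omega)
    have u1 := t1 0 0 (by omega) (by omega) (by omega) (by omega)
    have u2 := t0 0 1 (by omega) (by omega) (by omega) (by omega)
    push_cast at u0 u1 u2
    have hα : α = 0 := by linarith
    have hβ : β < 0 := by
      rcases hne with h' | h'
      · exact absurd hα h'
      · exact lt_of_le_of_ne (by linarith) h'
    have z : ∀ x : ℤ, 0 ≤ x → x ≤ f 1 → (0 ≤ 1 + b ∧ 1 + b ≤ D ∧ 0 ≤ x + a ∧ x + a ≤ f (1 + b)) := by
      intro x hx hx'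
      refine (sh x 1 (by omega) (by omega) hx hx').resolve_left ?_
      intro hc
      have := hc 0 0 (by omega) (by omega) (by omega) (by omega)
      rw [hα] at this
      push_cast at this
      linarith
    have z0 := z 0 (by omega) (by omega)
    have z1 := z (f 1) (by omega) (by omega)
    have hb1 : b = -1 := by omega
    subst hb1
    simp at z0 z1
    omega
  · left
    refine ⟨rfl, ?_⟩
    have ha0 : a ≠ 0 := by
      rintro rfl
      exact hv0 rfl
    have key : ∀ x : ℤ, ¬ (α = 0 ∧ (∀ x' y' : ℤ, 0 ≤ y' → y' ≤ D → 0 ≤ x' → x' ≤ f y' →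
        α * x' + β * y' ≤ α * x + β * (1:ℤ))) := by
      rintro x ⟨rfl, hc⟩
      have k0 := hc 0 0 (by omega) (by omega) (by omega) (by omega)
      have k1 := hc 0 D (by omega) (by omega) (by omega) (by omega)
      push_cast at k0 k1
      have : β ≠ 0 := by simpa using hne
      have hβ : 0 < β := lt_of_le_of_ne (by linarith) this.symm
      nlinarith
    rcases lt_or_gt_of_ne ha0 with ha | ha
    · right
      have t0 := (sh 0 1 (by omega) (by omega) (by omega) (by omega)).resolve_right (by omega)
      have hα : α ≠ 0 := fun h0 => key 0 ⟨h0, t0⟩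
      have u0 := t0 1 1 (by omega) (by omega) (by omega) (by omega)
      push_cast at u0
      have hα' : α < 0 := lt_of_le_of_ne (by linarith) hα
      have z := (sh 1 1 (by omega) (by omega) (by omega) (by omega)).resolve_left (by
        intro hc
        have := hc 0 1 (by omega) (by omega) (by omega) (by omega)
        push_cast at this
        linarith)
      omega
    · left
      have t0 := (sh (f 1) 1 (by omega) (by omega) (by omega) (by omega)).resolve_right
        (by simp; omega)
      have hα : α ≠ 0 := fun h0 => key (f 1) ⟨h0, t0⟩
      have u0 := t0 (f 1 - 1) 1 (by omega) (by omega) (by omega) (by omega)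
      push_cast at u0
      have hα' : 0 < α := lt_of_le_of_ne (by linarith) hα.symm
      have z := (sh (f 1 - 1) 1 (by omega) (by omega) (by omega) (by omega)).resolve_left (by
        intro hc
        have := hc (f 1) 1 (by omega) (by omega) (by omega) (by omega)
        push_cast at this
        linarith)
      simp at z
      omega
  · right; right
    have t0 := (sh 0 D (by omega) (by omega) (by omega) (by omega)).resolve_right (by omega)
    have t1 := (sh 1 D (by omega) (by omega) (by omega) (by omega)).resolve_right (by omega)
    have u0 := t0 1 D (by omega) (by omega) (by omega) (by omega)
    have u1 := t1 0 D (by omega) (by omega) (by omega) (by omega)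
    have u2 := t0 0 (D-1) (by omega) (by omega) (by omega) (by omega)
    push_cast at u0 u1 u2
    have hα : α = 0 := by linarith
    have hβ : 0 < β := by
      rcases hne with h' | h'
      · exact absurd hα h'
      · exact lt_of_le_of_ne (by linarith) h'.symm
    have z : ∀ x : ℤ, 0 ≤ x → x ≤ f (D-1) →
        (0 ≤ D-1 + b ∧ D-1 + b ≤ D ∧ 0 ≤ x + a ∧ x + a ≤ f (D-1 + b)) := by
      intro x hx hx'
      refine (sh x (D-1) (by omega) (by omega) hx hx').resolve_left ?_
      intro hc
      have := hc 0 D (by omega) (by omega) (by omega) (by omega)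
      rw [hα] at this
      push_cast at this
      linarith
    have z0 := z 0 (by omega) (by omega)
    have z1 := z (f (D-1)) (by omega) (by omega)
    have hb1 : b = 1 := by omega
    subst hb1
    rw [show D - 1 + 1 = D by ring] at z1
    have k1 := h.tan (D-1) 0
    have k2 := h.tan 0 (D-1)
    rw [show D - 1 + 1 = D by ring] at k1
    rw [show (0:ℤ) + 1 = 1 by ring] at k2
    have : f D - f (D-1) ≤ f 1 - f 0 := by
      by_contra hc
      push Not at hc
      nlinarith
    refine ⟨rfl, by omega, by omega⟩

lemma col_count {f : ℤ → ℤ} {D : ℤ} (h : GoodF f D) : columnVectorCount (PPf f D) ≤ 4 := by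
  have key : ∀ F : Finset (ℤ × ℤ), F.card ≤ 4 → {v : ℤ × ℤ | IsColumnVector (PPf f D) v} ⊆ F →
      columnVectorCount (PPf f D) ≤ 4 := by
    intro F hF hs
    refine le_trans (Set.ncard_le_ncard hs F.finite_toSet) ?_
    rwa [Set.ncard_coe_finset]
  rcases h.hα with hα | hα
  · refine key {(1,0),(-1,0),(0,-1),(0,1)} (by decide) ?_
    rintro ⟨a, b⟩ hv
    have := col_cases h a b hv
    simp
    omega
  · refine key {(1,0),(-1,0),(0,-1),(1,-1)} (by decide) ?_
    rintro ⟨a, b⟩ hv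
    have := col_cases h a b hv
    simp
    omega

lemma four_tri (s : ℕ) : ∃ a b c d : ℤ, 0 ≤ a ∧ 0 ≤ b ∧ 0 ≤ c ∧ 0 ≤ d ∧
    a * (a+1) + b * (b+1) + c * (c+1) + d * (d+1) = 2 * s := by
  have fix : ∀ k : ℤ, ∃ m : ℤ, 0 ≤ m ∧ m * (m+1) = k * (k+1) := by
    intro k
    rcases le_or_gt 0 k with h | h
    · exact ⟨k, h, rfl⟩
    · exact ⟨-k-1, by omega, by ring⟩
  obtain ⟨a, b, c, d, h⟩ := Nat.sum_four_squares (2 * s + 1)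
  zify at h
  have hodd : Odd ((a:ℤ) + b + c + d) := by
    have h2 : Odd ((a:ℤ)^2 + b^2 + c^2 + d^2) := ⟨s, h⟩
    simp only [Int.odd_add, Int.odd_pow, Int.even_pow] at *
    simpa using h2
  obtain ⟨k, hk⟩ := hodd
  obtain ⟨m1, p1, e1⟩ := fix k
  obtain ⟨m2, p2, e2⟩ := fix (k - c - d)
  obtain ⟨m3, p3, e3⟩ := fix (k - b - d)
  obtain ⟨m4, p4, e4⟩ := fix (k - b - c)
  refine ⟨m1, m2, m3, m4, p1, p2, p3, p4, ?_⟩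
  rw [e1, e2, e3, e4]
  have ha : (a:ℤ) = 2 * k + 1 - b - c - d := by linarith
  rw [ha] at h
  linarith

/-- Elementary kink. -/
def hk (D k y : ℤ) : ℤ := if k = 0 then 0 else max 0 (y - (D - 1 - k))

lemma hk_sum (D k : ℤ) (hk0 : 0 ≤ k) (hkD : k ≤ D - 3) :
    2 * ∑ y ∈ Finset.Icc 1 (D-1), hk D k y = k * (k+1) := by
  by_cases h0 : k = 0
  · simp [hk, h0]
  have key : ∀ m : ℤ, 0 ≤ m → ∀ n : ℕ,
      2 * ∑ y ∈ Finset.Icc 1 (m + n), max 0 (y - m) = n * (n + 1) := by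
    intro m hm n
    induction n with
    | zero =>
      simp
      refine Finset.sum_eq_zero fun y hy => ?_
      simp at hy
      omega
    | succ n ih =>
      have : Finset.Icc 1 (m + (n+1:ℕ)) = insert (m + (n+1:ℕ)) (Finset.Icc 1 (m + n)) := by
        ext y; simp; omega
      rw [this, Finset.sum_insert (by simp), mul_add, ih, max_eq_right (by push_cast; omega)]
      push_cast; ring
  have := key (D - 1 - k) (by omega) k.toNat
  rw [Int.toNat_of_nonneg hk0, show D - 1 - k + k = D - 1 by ring] at this
  simpa [hk, h0] using this

lemma hk_props (D k : ℤ) (hk0 : 0 ≤ k) (hkD : k ≤ D - 3) :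
    (∀ j, hk D k j - hk D k (j-1) ≤ hk D k (j+1) - hk D k j) ∧
    hk D k 0 = 0 ∧ hk D k 1 = 0 ∧ hk D k 2 = 0 ∧
    hk D k D - hk D k (D-1) = hk D k (D-1) - hk D k (D-2) ∧
    (∀ y, y ≤ D → 2 * hk D k y ≤ k * (k+1) + 2) := by
  unfold hk
  by_cases h0 : k = 0
  · simp [h0]
  · simp only [h0, if_false]
    refine ⟨fun j => by omega, by omega, by omega, by omega, by omega, fun y hy => ?_⟩
    have : max 0 (y - (D-1-k)) ≤ k + 1 := by omega
    nlinarith [show 1 ≤ k by omega]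

lemma final_of_good (d g : ℕ) (f : ℤ → ℤ) (q : ℤ) (h : GoodF f d)
    (hq : (g:ℤ) ≤ (d - 1) * q)
    (hg : (g:ℤ) = ∑ y ∈ Finset.Icc 1 ((d:ℤ)-1), (f y - 1))
    (hr : 2 * q - d ≤ f 0 + f d) :
    ∃ P : Set (ℝ × ℝ), IsMaximalPolygon P ∧ polygonGenus P = g ∧
      LatticeWidthIs P d ∧ ExpectedGonalityIs P d ∧
      ((g : ℝ) + 2 * (g : ℝ) / ((d : ℝ) - 1) + 2 * (d : ℝ) - 3) - ((d : ℝ) + 4) ≤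
        (g : ℝ) + (boundaryLatticeCount P : ℝ) - 3 - (columnVectorCount P : ℝ) := by
  refine ⟨PPf f d, maximal_PPf h, ?_, width_PPf h, gon_PPf h, ?_⟩
  · have := genus_PPf h
    rw [← hg] at this
    exact_mod_cast this
  · have hb := bdry_PPf h
    have hc : (columnVectorCount (PPf f d) : ℝ) ≤ 4 := by exact_mod_cast col_count h
    have hb' : 2 * (q:ℝ) - d + 2 * d ≤ boundaryLatticeCount (PPf f d) := by
      have : 2 * q - d + 2 * d ≤ boundaryLatticeCount (PPf f d) := by rw [hb]; linarith
      exact_mod_cast this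
    have hd : (3:ℝ) ≤ d := by exact_mod_cast h.hD
    have hq' : (g:ℝ) ≤ (d - 1) * q := by exact_mod_cast hq
    have : 2 * (g:ℝ) / (d - 1) ≤ 2 * q := by
      rw [div_le_iff₀ (by linarith)]
      linarith
    linarith

/-- For integers `d ≥ 3` and `g ≥ d³` there exists a maximal lattice polygon of genus
`g`, lattice width `d`, and expected gonality `d` with
`g + r(P) − 3 − c(P) ≥ U(g, d) − (d + 4)`. -/
theorem stmt9 (d g : ℕ) (hd : 3 ≤ d) (hg : d ^ 3 ≤ g) :
    ∃ P : Set (ℝ × ℝ), IsMaximalPolygon P ∧ polygonGenus P = g ∧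
      LatticeWidthIs P d ∧ ExpectedGonalityIs P d ∧
      ((g : ℝ) + 2 * (g : ℝ) / ((d : ℝ) - 1) + 2 * (d : ℝ) - 3) - ((d : ℝ) + 4) ≤
        (g : ℝ) + (boundaryLatticeCount P : ℝ) - 3 - (columnVectorCount P : ℝ) := by
  obtain ⟨q, s, hs, hsd⟩ : ∃ (q : ℤ) (s : ℕ), (g:ℤ) = (d - 1) * q - s ∧ (s:ℤ) ≤ d - 2 := by
    have a1 := Int.mul_ediv_self_le (x := -(g:ℤ)) (k := d - 1) (by omega)
    have a2 := Int.lt_mul_ediv_self_add (x := -(g:ℤ)) (k := (d:ℤ) - 1) (by omega)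
    refine ⟨-((-(g:ℤ)) / (d - 1)), ((d - 1) * (-((-(g:ℤ)) / (d - 1))) - g).toNat, ?_, ?_⟩ <;>
    rw [Int.toNat_of_nonneg (by linarith)] <;> linarith
  have hd3 : (3:ℤ) ≤ d := by exact_mod_cast hd
  have hq : (d:ℤ)^2 + 1 ≤ q := by
    by_contra hc
    have h1 : q ≤ (d:ℤ)^2 := by omega
    have h2 : (d:ℤ)^3 ≤ g := by exact_mod_cast hg
    nlinarith [mul_le_mul_of_nonneg_left h1 (by omega : (0:ℤ) ≤ d - 1)]
  have hqd : 2 * (d:ℤ) + 3 ≤ q := by nlinarith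
  by_cases hsp : d = 3 ∧ s = 1
  · obtain ⟨rfl, rfl⟩ := hsp
    refine final_of_good 3 g (fun y => q + 2 - y) q ?_ (by push_cast at *; omega) ?_
      (by push_cast at *; omega)
    · constructor <;> intros <;> push_cast at * <;> omega
    · have : Finset.Icc (1:ℤ) (((3:ℕ):ℤ) - 1) = {1, 2} := by decide
      rw [this, Finset.sum_insert (by simp), Finset.sum_singleton]
      push_cast at *; omega
  obtain ⟨k1, k2, k3, k4, p1, p2, p3, p4, hsum⟩ := four_tri s
  have bnd : ∀ k : ℤ, 0 ≤ k → k * (k+1) ≤ 2 * s → k ≤ d - 3 := by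
    intro k hk0 hk1
    by_contra hc
    have h1 : (d:ℤ) - 2 ≤ k := by omega
    have h2 : ((d:ℤ)-2) * (d - 1) ≤ 2 * (d - 2) := by nlinarith
    have h3 : (d:ℤ) ≤ 3 := by nlinarith
    have h4 : d = 3 := by omega
    have h5 : s ≠ 1 := fun h => hsp ⟨h4, h⟩
    have h6 : s = 0 := by omega
    rw [h6] at hk1
    push_cast at hk1
    nlinarith [show 1 ≤ k by omega]
  have n1 : 0 ≤ k1 * (k1+1) := by positivity
  have n2 : 0 ≤ k2 * (k2+1) := by positivity
  have n3 : 0 ≤ k3 * (k3+1) := by positivity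
  have n4 : 0 ≤ k4 * (k4+1) := by positivity
  have b1 := bnd k1 p1 (by linarith)
  have b2 := bnd k2 p2 (by linarith)
  have b3 := bnd k3 p3 (by linarith)
  have b4 := bnd k4 p4 (by linarith)
  obtain ⟨u1, v1, w1, x1, y1, z1⟩ := hk_props d k1 p1 b1
  obtain ⟨u2, v2, w2, x2, y2, z2⟩ := hk_props d k2 p2 b2
  obtain ⟨u3, v3, w3, x3, y3, z3⟩ := hk_props d k3 p3 b3
  obtain ⟨u4, v4, w4, x4, y4, z4⟩ := hk_props d k4 p4 b4
  have s1 := hk_sum d k1 p1 b1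
  have s2 := hk_sum d k2 p2 b2
  have s3 := hk_sum d k3 p3 b3
  have s4 := hk_sum d k4 p4 b4
  refine final_of_good d g (fun y => q + 1 - hk d k1 y - hk d k2 y - hk d k3 y - hk d k4 y) q
    ?_ (by linarith) ?_ ?_
  · constructor
    · exact hd3
    · intro j
      linarith [u1 j, u2 j, u3 j, u4 j]
    · simp only [v1, w1, x1, v2, w2, x2, v3, w3, x3, v4, w4, x4]
    · linarith
    · intro y hy hyd
      linarith [z1 y hyd, z2 y hyd, z3 y hyd, z4 y hyd]
    · left
      simp only [v1, w1, v2, w2, v3, w3, v4, w4]; ring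
  · have e : ∀ y, q + 1 - hk d k1 y - hk d k2 y - hk d k3 y - hk d k4 y - 1 =
        q - hk d k1 y - hk d k2 y - hk d k3 y - hk d k4 y := fun y => by ring
    simp only [e, Finset.sum_sub_distrib, Finset.sum_const, Int.card_Icc]
    have : (((d:ℤ) - 1 + 1 - 1).toNat) • q = (d - 1) * q := by
      rw [nsmul_eq_mul, Int.toNat_of_nonneg (by omega)]; ring
    rw [this]
    linarith
  · simp only [v1, v2, v3, v4]
    linarith [z1 d le_rfl, z2 d le_rfl, z3 d le_rfl, z4 d le_rfl]
end

section
/- Let d ≥ 3 be an integer and let P ⊆ ℝ × [0, d] be a lattice polygon with lattice width d. Suppose that at least 2d − 2 interior lattice points of P lie on the line ℝ × {1} and at least 2d − 2 interior lattice points of P lie on the line ℝ × {d − 1}. Then there exists an integer ℓ such that the shear transformation (x, y) ↦ (x + ℓy, y) maps P to a lattice polygon contained in ℝ × [0, d] that contains a crystal of length d. -/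
open Set

theorem convex_between_fst {C : Set (ℝ × ℝ)} (hC : Convex ℝ C) {a b x y : ℝ}
    (ha : (a, y) ∈ C) (hb : (b, y) ∈ C) (h1 : a ≤ x) (h2 : x ≤ b) : (x, y) ∈ C := by
  rcases eq_or_lt_of_le (h1.trans h2) with h | h
  · have : x = a := by linarith
    rwa [this]
  · have hp : 0 < b - a := by linarith
    have hh := hC ha hb (a := (b - x) / (b - a)) (b := (x - a) / (b - a))
      (div_nonneg (by linarith) hp.le) (div_nonneg (by linarith) hp.le) (by field_simp; ring)
    convert hh using 1
    ext
    · simp; field_simp; ring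
    · simp; field_simp; ring

theorem convex_between_snd {C : Set (ℝ × ℝ)} (hC : Convex ℝ C) {a b x y : ℝ}
    (ha : (x, a) ∈ C) (hb : (x, b) ∈ C) (h1 : a ≤ y) (h2 : y ≤ b) : (x, y) ∈ C := by
  rcases eq_or_lt_of_le (h1.trans h2) with h | h
  · have : y = a := by linarith
    rwa [this]
  · have hp : 0 < b - a := by linarith
    have hh := hC ha hb (a := (b - y) / (b - a)) (b := (y - a) / (b - a))
      (div_nonneg (by linarith) hp.le) (div_nonneg (by linarith) hp.le) (by field_simp; ring)
    convert hh using 1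
    ext
    · simp; field_simp; ring
    · simp; field_simp; ring

theorem exists_far_pair (S : Set ℤ) (n : ℕ) (hn : 0 < n) (h : n ≤ S.ncard) :
    ∃ m M : ℤ, m ∈ S ∧ M ∈ S ∧ m + n ≤ M + 1 := by
  have hf : S.Finite := Set.finite_of_ncard_pos (by omega)
  have hne : S.Nonempty := Set.nonempty_of_ncard_ne_zero (by omega)
  obtain ⟨m, hm, hm'⟩ := Set.exists_min_image S id hf hne
  obtain ⟨M, hM, hM'⟩ := Set.exists_max_image S id hf hne
  refine ⟨m, M, hm, hM, ?_⟩
  have hs : S ⊆ ((Finset.Icc m M : Finset ℤ) : Set ℤ) := by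
    intro x hx
    have h1 := hm' x hx
    have h2 := hM' x hx
    simp only [id] at h1 h2
    simp [h1, h2]
  have hc := Set.ncard_le_ncard hs (Finset.finite_toSet _)
  rw [Set.ncard_coe_finset, Int.card_Icc] at hc
  omega

/-- If a lattice polygon `P ⊆ ℝ × [0, d]` of lattice width `d ≥ 3` has at least `2d − 2`
interior lattice points on each of the lines `y = 1` and `y = d − 1`, then some shear
`(x, y) ↦ (x + ℓy, y)` maps `P` to a polygon in the strip containing a crystal of
length `d`. -/
theorem stmt10 (d : ℕ) (hd : 3 ≤ d) (P : Set (ℝ × ℝ))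
    (hP : IsLatticePolygon P) (hsub : P ⊆ strip (d : ℝ))
    (hlw : LatticeWidthIs P d)
    (h1 : 2 * d - 2 ≤ {x : ℤ | ((x, (1 : ℤ)) : ℤ × ℤ) ∈ interiorLatticePoints P}.ncard)
    (h2 : 2 * d - 2 ≤
      {x : ℤ | ((x, (d : ℤ) - 1) : ℤ × ℤ) ∈ interiorLatticePoints P}.ncard) :
    ∃ ℓ : ℤ, shearMap ℓ '' P ⊆ strip (d : ℝ) ∧ ContainsCrystal (shearMap ℓ '' P) d := by
  obtain ⟨S, hS, rfl⟩ := hP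
  obtain ⟨m1, M1, hm1, hM1, hr1⟩ := exists_far_pair _ _ (by omega) h1
  obtain ⟨m2, M2, hm2, hM2, hr2⟩ := exists_far_pair _ _ (by omega) h2
  set P := convexHull ℝ (latticeEmbed '' (S : Set (ℤ × ℤ))) with hPdef
  have hconv : Convex ℝ (interior P) := (convex_convexHull ℝ _).interior
  have hpos : (0 : ℤ) < (d : ℤ) - 2 := by omega
  obtain ⟨ℓ, s, hs0, hs1, hs⟩ : ∃ ℓ s : ℤ, 0 ≤ s ∧ s ≤ (d : ℤ) - 3 ∧
      m2 + ℓ * ((d : ℤ) - 2) = m1 + s := by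
    refine ⟨-((m2 - m1) / ((d : ℤ) - 2)), (m2 - m1) % ((d : ℤ) - 2),
      Int.emod_nonneg _ hpos.ne', ?_, ?_⟩
    · have := Int.emod_lt_of_pos (m2 - m1) hpos
      omega
    · have := Int.emod_add_mul_ediv (m2 - m1) ((d : ℤ) - 2)
      linarith
  refine ⟨ℓ, ?_, ?_⟩
  · rintro _ ⟨q, hq, rfl⟩
    have h := hsub hq
    exact ⟨h.1, h.2⟩
  let C : Set (ℝ × ℝ) := {q | (q.1 - (ℓ : ℝ) * q.2, q.2) ∈ interior P}
  have hCo : IsOpen C := isOpen_interior.preimage (by fun_prop)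
  have hCc : Convex ℝ C := by
    intro p hp q hq a b ha hb hab
    have := hconv hp hq ha hb hab
    change (_, _) ∈ interior P
    convert this using 1
    ext
    · simp; ring
    · simp
  have hCs : C ⊆ interior (shearMap ℓ '' P) := by
    refine interior_maximal ?_ hCo
    intro q hq
    exact ⟨_, interior_subset hq, by simp [shearMap]⟩
  have key : ∀ x j : ℤ, (x, j) ∈ interiorLatticePoints P →
      (((x + ℓ * j : ℤ) : ℝ), (j : ℝ)) ∈ C := by
    intro x j h
    change (_, _) ∈ interior P
    convert (show latticeEmbed (x, j) ∈ interior P from h) using 1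
    ext
    · simp [latticeEmbed]
    · simp [latticeEmbed]
  have a1 := key _ _ hm1
  have b1 := key _ _ hM1
  have a2 := key _ _ hm2
  have b2 := key _ _ hM2
  refine ⟨m2 + ℓ * ((d : ℤ) - 1), ?_⟩
  intro i j hi0 hid hj1 hjd
  apply hCs
  have hx : m2 + ℓ * ((d : ℤ) - 1) = m1 + s + ℓ := by linarith
  have hn : ((2 * d - 2 : ℕ) : ℤ) = 2 * d - 2 := by omega
  rw [hn] at hr1 hr2
  have c1 : (((m2 + ℓ * ((d : ℤ) - 1) + i : ℤ) : ℝ), ((1 : ℤ) : ℝ)) ∈ C :=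
    convex_between_fst hCc a1 b1 (Int.cast_le.mpr (by rw [hx]; linarith))
      (Int.cast_le.mpr (by rw [hx]; linarith))
  have c2 : (((m2 + ℓ * ((d : ℤ) - 1) + i : ℤ) : ℝ), (((d : ℤ) - 1 : ℤ) : ℝ)) ∈ C :=
    convex_between_fst hCc a2 b2 (Int.cast_le.mpr (by linarith))
      (Int.cast_le.mpr (by linarith))
  exact convex_between_snd hCc c1 c2 (Int.cast_le.mpr hj1) (Int.cast_le.mpr hjd)
end

section
/- Let d ≥ 3 and g ≥ d³ be integers, and let P ⊆ ℝ × [0, d] be a lattice polygon with lattice width d and exactly g interior lattice points. Then there exists an integer ℓ such that the shear transformation (x, y) ↦ (x + ℓy, y) maps P to a lattice polygon contained in ℝ × [0, d] that contains a crystal of length d. -/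
open Set

lemma aux_row_s11 {P : Set (ℝ × ℝ)} (hP : Convex ℝ P) {a b h p y0 t x y : ℝ} (hab : a < b)
    (hA : (a, h) ∈ interior P) (hB : (b, h) ∈ interior P) (hp : (p, y0) ∈ P)
    (ht : 0 < t) (ht1 : t ≤ 1) (hy : y = t * h + (1 - t) * y0)
    (h1 : t * a + (1 - t) * p ≤ x) (h2 : x ≤ t * b + (1 - t) * p) :
    (x, y) ∈ interior P := by
  have hc : ((x - (1 - t) * p) / t, h) ∈ interior P := by
    have hba : 0 < b - a := sub_pos.2 hab
    set c := (x - (1 - t) * p) / t with hcdef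
    have hca : a ≤ c := by rw [hcdef, le_div_iff₀ ht]; linarith
    have hcb : c ≤ b := by rw [hcdef, div_le_iff₀ ht]; linarith
    have := hP.interior hA hB (a := (b - c) / (b - a)) (b := (c - a) / (b - a))
      (div_nonneg (by linarith) hba.le) (div_nonneg (by linarith) hba.le)
      (by field_simp; ring)
    convert this using 1
    ext
    · simp; field_simp; ring
    · simp; field_simp; ring
  have := hP.combo_interior_self_mem_interior hc hp ht (sub_nonneg.2 ht1) (by ring)
  convert this using 1
  ext
  · simp; field_simp; ring
  · simp [hy]

lemma aux_cong (L R L' R' : ℝ) (m : ℤ) (hm : 1 ≤ m) (h : (m : ℝ) ≤ R - L) (h' : 1 ≤ R' - L') :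
    ∃ u v : ℤ, L ≤ u ∧ (u : ℝ) ≤ R ∧ L' ≤ v ∧ (v : ℝ) ≤ R' ∧ m ∣ u - v := by
  have e0 := Int.emod_nonneg (⌈L'⌉ - ⌈L⌉) (show m ≠ 0 by omega)
  have e1 := Int.emod_lt_of_pos (⌈L'⌉ - ⌈L⌉) (show 0 < m by omega)
  have e2 := Int.mul_ediv_add_emod (⌈L'⌉ - ⌈L⌉) m
  set r := (⌈L'⌉ - ⌈L⌉) % m
  have c1 := Int.le_ceil L
  have c2 := Int.ceil_lt_add_one L
  have c3 := Int.le_ceil L'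
  have c4 := Int.ceil_lt_add_one L'
  have e0' : (0 : ℝ) ≤ r := by exact_mod_cast e0
  have e1' : (r : ℝ) ≤ m - 1 := by
    have : r ≤ m - 1 := by omega
    exact_mod_cast this
  refine ⟨⌈L⌉ + r, ⌈L'⌉, ?_, ?_, c3, by linarith, ⟨-((⌈L'⌉ - ⌈L⌉) / m), ?_⟩⟩
  · push_cast; linarith
  · push_cast; linarith
  · linarith

lemma aux_spread (F : Finset ℤ) (n : ℕ) (h : n < F.card) :
    ∃ a ∈ F, ∃ b ∈ F, (n : ℤ) ≤ b - a := by
  have hne : F.Nonempty := Finset.card_pos.1 (by omega)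
  refine ⟨F.min' hne, F.min'_mem _, F.max' hne, F.max'_mem _, ?_⟩
  have hs : F ⊆ Finset.Icc (F.min' hne) (F.max' hne) := fun x hx =>
    Finset.mem_Icc.2 ⟨F.min'_le _ hx, F.le_max' _ hx⟩
  have := Finset.card_le_card hs
  rw [Int.card_Icc] at this
  omega

lemma aux_rowcount (d : ℕ) (hd : 3 ≤ d) (P : Set (ℝ × ℝ)) (hsub : P ⊆ strip (d : ℝ))
    (hg : d ^ 3 ≤ (interiorLatticePoints P).ncard) :
    ∃ k a b : ℤ, 1 ≤ k ∧ k ≤ d - 1 ∧ (d : ℤ) ^ 2 + d + 1 ≤ b - a ∧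
      ((a : ℝ), (k : ℝ)) ∈ interior P ∧ ((b : ℝ), (k : ℝ)) ∈ interior P := by
  have hpos : 0 < d ^ 3 := by positivity
  have hfin : (interiorLatticePoints P).Finite := Set.finite_of_ncard_pos (by omega)
  rw [Set.ncard_eq_toFinset_card _ hfin] at hg
  have hmaps : ∀ p ∈ hfin.toFinset, p.2 ∈ Finset.Icc (1 : ℤ) (d - 1) := by
    intro p hp
    rw [Set.Finite.mem_toFinset] at hp
    have h1 : latticeEmbed p ∈ interior (Prod.snd ⁻¹' (Set.Icc (0 : ℝ) d)) :=
      interior_mono (fun q hq => hsub hq) hp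
    rw [← isOpenMap_snd.preimage_interior_eq_interior_preimage continuous_snd,
      interior_Icc] at h1
    obtain ⟨h2, h3⟩ := h1
    simp only [latticeEmbed] at h2 h3
    have h2' : 0 < p.2 := by exact_mod_cast h2
    have h3' : p.2 < d := by exact_mod_cast h3
    rw [Finset.mem_Icc]; omega
  have hcard : (Finset.Icc (1 : ℤ) (d - 1)).card * (d ^ 2 + d + 1) < hfin.toFinset.card := by
    refine lt_of_lt_of_le ?_ hg
    rw [Int.card_Icc]
    obtain ⟨e, rfl⟩ : ∃ e, d = e + 1 := ⟨d - 1, by omega⟩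
    have : ((((e + 1 : ℕ) : ℤ) - 1 + 1 - 1).toNat) = e := by omega
    rw [this]
    ring_nf; omega
  obtain ⟨k, hk, hlt⟩ := Finset.exists_lt_card_fiber_of_mul_lt_card_of_maps_to hmaps hcard
  rw [Finset.mem_Icc] at hk
  have hinj : Set.InjOn Prod.fst ((hfin.toFinset.filter (fun x => x.2 = k) : Finset (ℤ × ℤ)) : Set (ℤ × ℤ)) := by
    intro x hx y hy hxy
    simp only [Finset.coe_filter, Set.mem_ofPred_eq] at hx hy
    exact Prod.ext hxy (hx.2.trans hy.2.symm)
  rw [← Finset.card_image_of_injOn hinj] at hlt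
  obtain ⟨a, ha, b, hb, hab⟩ := aux_spread _ _ hlt
  have key : ∀ c ∈ (hfin.toFinset.filter (fun x => x.2 = k)).image Prod.fst,
      ((c : ℝ), (k : ℝ)) ∈ interior P := by
    intro c hc
    rw [Finset.mem_image] at hc
    obtain ⟨q, hq, rfl⟩ := hc
    rw [Finset.mem_filter, Set.Finite.mem_toFinset] at hq
    obtain ⟨hq, rfl⟩ := hq
    exact hq
  exact ⟨k, a, b, hk.1, hk.2, by push_cast at hab; linarith, key a ha, key b hb⟩

lemma aux_touch (d : ℕ) (hd : 3 ≤ d) (P : Set (ℝ × ℝ))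
    (hP : IsLatticePolygon P) (hsub : P ⊆ strip (d : ℝ))
    (hlw : LatticeWidthIs P d) : (∃ p : ℝ, (p, (0 : ℝ)) ∈ P) ∧ ∃ q : ℝ, (q, (d : ℝ)) ∈ P := by
  obtain ⟨S, -, rfl⟩ := hP
  have hS : ∀ s ∈ S, latticeEmbed s ∈ convexHull ℝ (latticeEmbed '' (S : Set (ℤ × ℤ))) :=
    fun s hs => subset_convexHull ℝ _ (Set.mem_image_of_mem _ hs)
  have hb : ∀ s ∈ S, 0 ≤ s.2 ∧ s.2 ≤ d := by
    intro s hs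
    have := hsub (hS s hs)
    simp only [strip, latticeEmbed, Set.mem_ofPred_eq] at this
    exact ⟨by exact_mod_cast this.1, by exact_mod_cast this.2⟩
  have hcast : ((d - 1 : ℕ) : ℝ) = d - 1 := by
    rw [Nat.cast_sub (by omega)]; simp
  constructor
  · by_contra hcon
    have h1 : ∀ s ∈ S, 1 ≤ s.2 := by
      intro s hs
      rcases (hb s hs).1.eq_or_lt with h | h
      · exfalso; apply hcon
        refine ⟨s.1, ?_⟩
        have := hS s hs
        rw [latticeEmbed, ← h] at this
        simpa using this
      · omega
    have h2 : convexHull ℝ (latticeEmbed '' (S : Set (ℤ × ℤ))) ⊆ {q : ℝ × ℝ | 1 ≤ q.2} := by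
      apply convexHull_min
      · rintro _ ⟨s, hs, rfl⟩
        simp only [latticeEmbed, Set.mem_ofPred_eq]
        exact_mod_cast h1 s hs
      · exact convex_halfSpace_ge (LinearMap.isLinear (LinearMap.snd ℝ ℝ ℝ)) 1
    have := hlw.2 (show d - 1 ∈ _ from ⟨by omega, fun q => (q.1, q.2 - 1),
      ⟨1, 0, 0, 1, 0, -1, by norm_num, fun p => by simp [sub_eq_add_neg]⟩, by
        rintro _ ⟨q, hq, rfl⟩
        have a1 : 1 ≤ q.2 := h2 hq
        have a2 : q.2 ≤ d := (hsub hq).2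
        refine ⟨?_, ?_⟩
        · show 0 ≤ q.2 - 1
          linarith
        · show q.2 - 1 ≤ _
          rw [hcast]; linarith⟩)
    omega
  · by_contra hcon
    have h1 : ∀ s ∈ S, s.2 ≤ d - 1 := by
      intro s hs
      rcases (hb s hs).2.eq_or_lt with h | h
      · exfalso; apply hcon
        refine ⟨s.1, ?_⟩
        have := hS s hs
        rw [latticeEmbed, h] at this
        simpa using this
      · omega
    have h2 : convexHull ℝ (latticeEmbed '' (S : Set (ℤ × ℤ))) ⊆ {q : ℝ × ℝ | q.2 ≤ d - 1} := by
      apply convexHull_min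
      · rintro _ ⟨s, hs, rfl⟩
        simp only [latticeEmbed, Set.mem_ofPred_eq]
        exact_mod_cast h1 s hs
      · exact convex_halfSpace_le (LinearMap.isLinear (LinearMap.snd ℝ ℝ ℝ)) _
    have := hlw.2 (show d - 1 ∈ _ from ⟨by omega, fun q => q,
      ⟨1, 0, 0, 1, 0, 0, by norm_num, fun p => by simp⟩, by
        rintro _ ⟨q, hq, rfl⟩
        have a1 : q.2 ≤ d - 1 := h2 hq
        refine ⟨(hsub hq).1, ?_⟩
        rw [hcast]; exact a1⟩)
    omega

theorem stmt11 (d g : ℕ) (hd : 3 ≤ d) (hg : d ^ 3 ≤ g) (P : Set (ℝ × ℝ))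
    (hP : IsLatticePolygon P) (hsub : P ⊆ strip (d : ℝ))
    (hlw : LatticeWidthIs P d) (hgen : polygonGenus P = g) :
    ∃ ℓ : ℤ, shearMap ℓ '' P ⊆ strip (d : ℝ) ∧ ContainsCrystal (shearMap ℓ '' P) d := by
  have hconv : Convex ℝ P := by
    obtain ⟨S, -, rfl⟩ := hP
    exact convex_convexHull ℝ _
  obtain ⟨⟨p, hp⟩, q, hq⟩ := aux_touch d hd P hP hsub hlw
  subst hgen
  obtain ⟨k, a, b, hk1, hk2, hab, hA, hB⟩ := aux_rowcount d hd P hsub hg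
  have hdR : (3 : ℝ) ≤ d := by exact_mod_cast hd
  have hk1R : (1 : ℝ) ≤ k := by exact_mod_cast hk1
  have hk2R : (k : ℝ) ≤ d - 1 := by exact_mod_cast hk2
  have habR : (d : ℝ) ^ 2 + d + 1 ≤ b - a := by exact_mod_cast hab
  have hablt : (a : ℝ) < b := by nlinarith
  have hk0 : (0 : ℝ) < k := by linarith
  have hdk0 : (0 : ℝ) < d - k := by linarith
  have row1 : ∀ x : ℝ, 1 / (k : ℝ) * a + (1 - 1 / (k : ℝ)) * p ≤ x →
      x ≤ 1 / (k : ℝ) * b + (1 - 1 / (k : ℝ)) * p → (x, (1 : ℝ)) ∈ interior P := by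
    intro x h1 h2
    refine aux_row_s11 hconv hablt hA hB hp (by positivity) ?_ ?_ h1 h2
    · rw [div_le_one hk0]; exact hk1R
    · field_simp; ring
  have row2 : ∀ x : ℝ, 1 / ((d : ℝ) - k) * a + (1 - 1 / ((d : ℝ) - k)) * q ≤ x →
      x ≤ 1 / ((d : ℝ) - k) * b + (1 - 1 / ((d : ℝ) - k)) * q →
      (x, (d : ℝ) - 1) ∈ interior P := by
    intro x h1 h2
    refine aux_row_s11 hconv hablt hA hB hq (by positivity) ?_ ?_ h1 h2
    · rw [div_le_one hdk0]; linarith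
    · field_simp; ring
  have w : ∀ K : ℝ, 0 < K → K ≤ d - 1 → (d : ℝ) + 1 ≤ 1 / K * (b - a) := by
    intro K h1 h2
    rw [one_div_mul_eq_div, le_div_iff₀ h1]; nlinarith
  have w' : ∀ K : ℝ, 0 < K → 2 * K ≤ d → (d : ℝ) + (d - 2) ≤ 1 / K * (b - a) := by
    intro K h1 h2
    rw [one_div_mul_eq_div, le_div_iff₀ h1]; nlinarith
  have hm : (1 : ℤ) ≤ (d : ℤ) - 2 := by omega
  have huv : ∃ u v : ℤ, 1 / (k : ℝ) * a + (1 - 1 / (k : ℝ)) * p ≤ u ∧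
      (u : ℝ) ≤ 1 / (k : ℝ) * b + (1 - 1 / (k : ℝ)) * p - d ∧
      1 / ((d : ℝ) - k) * a + (1 - 1 / ((d : ℝ) - k)) * q ≤ v ∧
      (v : ℝ) ≤ 1 / ((d : ℝ) - k) * b + (1 - 1 / ((d : ℝ) - k)) * q - d ∧
      (d : ℤ) - 2 ∣ u - v := by
    rcases le_total (2 * (k : ℝ)) d with h | h
    · apply aux_cong _ _ _ _ _ hm
      · have := w' k hk0 h
        push_cast; linarith
      · have := w (d - k) hdk0 (by linarith)
        linarith
    · obtain ⟨v, u, h1, h2, h3, h4, h5⟩ := aux_cong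
        (1 / ((d : ℝ) - k) * a + (1 - 1 / ((d : ℝ) - k)) * q)
        (1 / ((d : ℝ) - k) * b + (1 - 1 / ((d : ℝ) - k)) * q - d)
        (1 / (k : ℝ) * a + (1 - 1 / (k : ℝ)) * p)
        (1 / (k : ℝ) * b + (1 - 1 / (k : ℝ)) * p - d) _ hm
        (by
          have := w' (d - k) hdk0 (by linarith)
          push_cast; linarith)
        (by
          have := w k hk0 hk2R
          linarith)
      exact ⟨u, v, h3, h4, h1, h2, (dvd_sub_comm).1 h5⟩
  obtain ⟨u, v, u1, u2, v1, v2, ℓ, hℓ⟩ := huv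
  refine ⟨ℓ, ?_, u + ℓ, ?_⟩
  · rintro _ ⟨z, hz, rfl⟩
    exact ⟨(hsub hz).1, (hsub hz).2⟩
  intro i j hi0 hid hj1 hjd
  have hpre : shearMap ℓ '' P = shearMap (-ℓ) ⁻¹' P := by
    refine congrFun (Set.image_eq_preimage_of_inverse ?_ ?_) P
    · intro z; ext <;> simp [shearMap]
    · intro z; ext <;> simp [shearMap]
  have hcont : Continuous (shearMap (-ℓ)) := by
    unfold shearMap; fun_prop
  show latticeEmbed (u + ℓ + i, j) ∈ interior (shearMap ℓ '' P)
  rw [hpre]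
  apply preimage_interior_subset_interior_preimage hcont
  have hi0R : (0 : ℝ) ≤ i := by exact_mod_cast hi0
  have hidR : (i : ℝ) ≤ d := by exact_mod_cast hid
  have hj1R : (1 : ℝ) ≤ j := by exact_mod_cast hj1
  have hjdR : (j : ℝ) ≤ d - 1 := by exact_mod_cast hjd
  have hℓR : (u : ℝ) - v = (d - 2) * ℓ := by exact_mod_cast hℓ
  have hvR : (v : ℝ) = u - (d - 2) * ℓ := by linarith
  have X := row1 (u + i) (by linarith) (by linarith)
  have Y := row2 (v + i) (by linarith) (by linarith)
  have hd2 : (0 : ℝ) < d - 2 := by linarith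
  have Z := hconv.interior X Y (a := (d - 1 - j) / (d - 2)) (b := (j - 1) / (d - 2))
    (div_nonneg (by linarith) hd2.le) (div_nonneg (by linarith) hd2.le)
    (by field_simp; ring)
  show shearMap (-ℓ) (latticeEmbed (u + ℓ + i, j)) ∈ interior P
  convert Z using 1
  ext
  · simp [shearMap, latticeEmbed, hvR]; field_simp; ring
  · simp [shearMap, latticeEmbed]; field_simp; ring
end
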